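/- Every C¹ flow on the two-torus 𝕋² without critical points and without periodic orbits is uniquely ergodic: it admits exactly one invariant Borel probability measure. -/

import Mathlib

open MeasureTheory Set
noncomputable section

/-- The two-torus `𝕋² = ℝ²/ℤ²`. -/
abbrev T2 : Type := AddCircle (1:ℝ) × AddCircle (1:ℝ)

/-- Projection `ℝ² → 𝕋²`. -/
def projT2 (v : ℝ × ℝ) : T2 := (↑v.1, ↑v.2)

/-- A `C¹` flow on the two-torus, encoded by a jointly `C¹` lift to ℝ². -/
structure C1FlowT2 where
  flow : ℝ → T2 → T2
  lift : ℝ → ℝ × ℝ → ℝ × ℝ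
  lift_contDiff : ContDiff ℝ 1 (Function.uncurry lift)
  lift_proj : ∀ t v, projT2 (lift t v) = flow t (projT2 v)
  flow_zero : ∀ x, flow 0 x = x
  flow_add : ∀ t s x, flow (t + s) x = flow t (flow s x)

namespace C1FlowT2
/-- The generating vector field of the flow (read in the universal cover). -/
def vf (h : C1FlowT2) (v : ℝ × ℝ) : ℝ × ℝ := deriv (fun t => h.lift t v) 0
/-- The flow has no critical points: its generating vector field never vanishes. -/
def NoCriticalPoints (h : C1FlowT2) : Prop := ∀ v, h.vf v ≠ 0
/-- The flow has no periodic orbits. -/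
def NoPeriodicOrbits (h : C1FlowT2) : Prop := ∀ x T, 0 < T → h.flow T x ≠ x
end C1FlowT2

/-- A closed transversal curve of the flow: a `C¹` embedded circle, everywhere
transverse to the generating vector field, meeting every orbit. -/
structure ClosedTransversal (h : C1FlowT2) where
  γ : AddCircle (1:ℝ) → T2
  lift : ℝ → ℝ × ℝ
  lift_contDiff : ContDiff ℝ 1 lift
  lift_proj : ∀ s : ℝ, projT2 (lift s) = γ ↑s
  inj : Function.Injective γ
  transverse : ∀ s : ℝ,
    (deriv lift s).1 * (h.vf (lift s)).2 - (deriv lift s).2 * (h.vf (lift s)).1 ≠ 0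
  meets : ∀ x : T2, ∃ t : ℝ, h.flow t x ∈ Set.range γ

/-- First return time to the transversal: `u x = inf {t > 0 | h_t x ∈ γ(𝕊¹)}`. -/
def returnTime (h : C1FlowT2) (Γ : ClosedTransversal h) (x : T2) : ℝ :=
  sInf {t : ℝ | 0 < t ∧ h.flow t x ∈ Set.range Γ.γ}

/-- `F : CircleDeg1Lift` is a lift of the first return map of the flow to the
transversal `Γ`, read in the parametrization of `Γ` by the circle. -/
def ReturnMapLift (h : C1FlowT2) (Γ : ClosedTransversal h) (F : CircleDeg1Lift) : Prop :=
  ∀ s : ℝ, Γ.γ ↑(F s) = h.flow (returnTime h Γ (Γ.γ ↑s)) (Γ.γ ↑s)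

/-- A real number is of constant type if it is irrational and the partial quotients
of its continued fraction expansion are bounded. -/
def IsOfConstantType (ω : ℝ) : Prop :=
  Irrational ω ∧ ∃ B : ℝ, ∀ n : ℕ, ∀ a ∈ (GenContFract.of ω).partDens.get? n, a ≤ B

/-- `C¹` norm of an observable on the torus. -/
def C1Norm (f : T2 → ℝ) : ℝ :=
  (⨆ v : ℝ × ℝ, |f (projT2 v)|) + ⨆ v : ℝ × ℝ, ‖fderiv ℝ (fun w => f (projT2 w)) v‖

/-- Ergodic integral `H_{x,T}(f) = ∫₀^T f(h_t x) dt`. -/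
def ergInt (h : C1FlowT2) (f : T2 → ℝ) (x : T2) (T : ℝ) : ℝ :=
  ∫ t in (0:ℝ)..T, f (h.flow t x)

section

open Filter Topology

/-- Integer vectors of the plane. -/
def latticeVec (k : ℤ × ℤ) : ℝ × ℝ := ((k.1 : ℝ), (k.2 : ℝ))

lemma latticeVec_add (k l : ℤ × ℤ) : latticeVec (k + l) = latticeVec k + latticeVec l := by
  simp [latticeVec]

/-- Rotation of the plane by a right angle. -/
def rotate (v : ℝ × ℝ) : ℝ × ℝ := (-v.2, v.1)

/-- A `C¹` flow of the plane commuting with integer translations and inducing on the torus a flow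
without critical points and without periodic orbits. -/
structure PlaneFlow where
  Φ : ℝ → ℝ × ℝ → ℝ × ℝ
  contDiff : ContDiff ℝ 1 (Function.uncurry Φ)
  zero : ∀ v, Φ 0 v = v
  add : ∀ t s v, Φ (t + s) v = Φ t (Φ s v)
  equivariant : ∀ t v k, Φ t (v + latticeVec k) = Φ t v + latticeVec k
  noncritical : ∀ v, deriv (fun t => Φ t v) 0 ≠ 0
  nonperiodic : ∀ v T k, 0 < T → Φ T v ≠ v + latticeVec k

namespace PlaneFlow

variable (φ : PlaneFlow)

/-- The generating vector field. -/
def field (v : ℝ × ℝ) : ℝ × ℝ := deriv (fun t => φ.Φ t v) 0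

/-- A field transverse to the flow. -/
def normal (v : ℝ × ℝ) : ℝ × ℝ := rotate (φ.field v)

/-- Flow box parametrization: flow for time `p.1` from the point of parameter `p.2` on the straight
transversal through `y`. -/
def box (y : ℝ × ℝ) (p : ℝ × ℝ) : ℝ × ℝ := φ.Φ p.1 (y + p.2 • φ.normal y)

lemma continuous_uncurry : Continuous (Function.uncurry φ.Φ) := φ.contDiff.continuous

lemma continuous_flow (t : ℝ) : Continuous (φ.Φ t) :=
  φ.continuous_uncurry.comp (Continuous.prodMk_right t)

lemma neg_apply (t : ℝ) (v : ℝ × ℝ) : φ.Φ (-t) (φ.Φ t v) = v := by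
  rw [← φ.add, neg_add_cancel, φ.zero]

lemma apply_neg (t : ℝ) (v : ℝ × ℝ) : φ.Φ t (φ.Φ (-t) v) = v := by
  rw [← φ.add, add_neg_cancel, φ.zero]

lemma field_eq (v : ℝ × ℝ) :
    φ.field v = fderiv ℝ (Function.uncurry φ.Φ) (0, v) (1, 0) := by
  have h1 : HasFDerivAt (Function.uncurry φ.Φ) (fderiv ℝ (Function.uncurry φ.Φ) (0, v)) (0, v) :=
    (φ.contDiff.differentiable one_ne_zero).differentiableAt.hasFDerivAt
  have h2 : HasDerivAt (fun t : ℝ => (t, v)) ((1 : ℝ), (0 : ℝ × ℝ)) 0 :=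
    (hasDerivAt_id _).prodMk (hasDerivAt_const _ _)
  exact (h1.comp_hasDerivAt (0 : ℝ) h2).deriv

lemma continuous_field : Continuous φ.field := by
  have h := φ.contDiff.continuous_fderiv one_ne_zero
  have : φ.field = fun v => fderiv ℝ (Function.uncurry φ.Φ) (0, v) (1, 0) := by
    funext v; exact φ.field_eq v
  rw [this]
  fun_prop

lemma continuous_normal : Continuous φ.normal := by
  have := φ.continuous_field
  unfold normal rotate
  fun_prop

lemma contDiff_box (y : ℝ × ℝ) : ContDiff ℝ 1 (φ.box y) := by
  have : φ.box y = Function.uncurry φ.Φ ∘ fun p : ℝ × ℝ => (p.1, y + p.2 • φ.normal y) := rfl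
  rw [this]
  exact φ.contDiff.comp (by fun_prop)

lemma continuous_box (y : ℝ × ℝ) : Continuous (φ.box y) := (φ.contDiff_box y).continuous

lemma box_zero (y : ℝ × ℝ) (s : ℝ) : φ.box y (0, s) = y + s • φ.normal y := by
  simp [box, φ.zero]

lemma box_zero_zero (y : ℝ × ℝ) : φ.box y (0, 0) = y := by simp [box_zero]

lemma flow_box (y : ℝ × ℝ) (r : ℝ) (p : ℝ × ℝ) :
    φ.Φ r (φ.box y p) = φ.box y (r + p.1, p.2) := by
  simp [box, φ.add]

lemma hasFDerivAt_box (y : ℝ × ℝ) :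
    HasFDerivAt (φ.box y) ((ContinuousLinearMap.fst ℝ ℝ ℝ).smulRight (φ.field y) +
      (ContinuousLinearMap.snd ℝ ℝ ℝ).smulRight (φ.normal y)) (0, 0) := by
  have h1 : HasFDerivAt (φ.box y) (fderiv ℝ (φ.box y) (0, 0)) (0, 0) :=
    ((φ.contDiff_box y).differentiable one_ne_zero).differentiableAt.hasFDerivAt
  have h2 : HasDerivAt (fun t : ℝ => (t, (0 : ℝ))) ((1 : ℝ), (0 : ℝ)) 0 :=
    (hasDerivAt_id _).prodMk (hasDerivAt_const _ _)
  have h3 : HasDerivAt (fun t : ℝ => ((0 : ℝ), t)) ((0 : ℝ), (1 : ℝ)) 0 :=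
    (hasDerivAt_const _ _).prodMk (hasDerivAt_id _)
  have e1 : fderiv ℝ (φ.box y) (0, 0) (1, 0) = φ.field y := by
    rw [← (HasFDerivAt.comp_hasDerivAt (f := fun t : ℝ => (t, (0 : ℝ))) (0 : ℝ) h1 h2).deriv]
    simp [field, box, Function.comp_def]
  have e2 : fderiv ℝ (φ.box y) (0, 0) (0, 1) = φ.normal y := by
    rw [← (HasFDerivAt.comp_hasDerivAt (f := fun t : ℝ => ((0 : ℝ), t)) (0 : ℝ) h1 h3).deriv]
    have : (φ.box y ∘ fun t : ℝ => ((0 : ℝ), t)) = fun s => y + s • φ.normal y := by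
      funext s; exact φ.box_zero y s
    rw [this]
    have h4 : HasDerivAt (fun s : ℝ => y + s • φ.normal y) ((1 : ℝ) • φ.normal y) 0 :=
      ((hasDerivAt_id (0 : ℝ)).smul_const _).const_add _
    simpa using h4.deriv
  convert h1 using 1
  ext <;> simp [e1, e2]

lemma exists_equiv_box (y : ℝ × ℝ) : ∃ L : (ℝ × ℝ) ≃L[ℝ] (ℝ × ℝ),
    HasFDerivAt (φ.box y) (L : (ℝ × ℝ) →L[ℝ] (ℝ × ℝ)) (0, 0) := by
  set A : (ℝ × ℝ) →L[ℝ] (ℝ × ℝ) := (ContinuousLinearMap.fst ℝ ℝ ℝ).smulRight (φ.field y) +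
      (ContinuousLinearMap.snd ℝ ℝ ℝ).smulRight (φ.normal y) with hA
  have hinj : Function.Injective A.toLinearMap := by
    rw [← LinearMap.ker_eq_bot, LinearMap.ker_eq_bot']
    rintro ⟨a, b⟩ hab
    have hne : φ.field y ≠ 0 := φ.noncritical y
    rcases hX : φ.field y with ⟨u, v⟩
    have huv : 0 < u ^ 2 + v ^ 2 := by
      by_contra hcon
      have hu : u = 0 := by nlinarith [sq_nonneg u, sq_nonneg v]
      have hv : v = 0 := by nlinarith [sq_nonneg u, sq_nonneg v]
      exact hne (by rw [hX, hu, hv]; rfl)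
    simp [hA, normal, rotate, hX, Prod.ext_iff] at hab
    obtain ⟨h1, h2⟩ := hab
    have ha : a * (u ^ 2 + v ^ 2) = 0 := by linear_combination u * h1 + v * h2
    have hb : b * (u ^ 2 + v ^ 2) = 0 := by linear_combination u * h2 - v * h1
    simp only [mul_eq_zero, huv.ne', or_false] at ha hb
    simp [ha, hb]
  refine ⟨(LinearEquiv.ofInjectiveEndo A.toLinearMap hinj).toContinuousLinearEquiv, ?_⟩
  convert φ.hasFDerivAt_box y using 1
  ext <;> rfl

/-- Flow boxes exist, and their transverse coordinate increases along the transverse field. -/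
lemma exists_chart (y : ℝ × ℝ) : ∃ e : OpenPartialHomeomorph (ℝ × ℝ) (ℝ × ℝ),
    (∀ p, e p = φ.box y p) ∧ (0, 0) ∈ e.source ∧ ∃ W ∈ 𝓝 y, ∀ p ∈ W,
      DifferentiableAt ℝ (fun z => (e.symm z).2) p ∧
      ∀ q ∈ W, 0 < fderiv ℝ (fun z => (e.symm z).2) p (φ.normal q) := by
  obtain ⟨L, hL⟩ := φ.exists_equiv_box y
  have hc : ContDiffAt ℝ 1 (φ.box y) (0, 0) := (φ.contDiff_box y).contDiffAt
  set e := hc.toOpenPartialHomeomorph (φ.box y) hL one_ne_zero with he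
  have hcoe : ∀ p, e p = φ.box y p := fun p => by
    rw [he, ContDiffAt.toOpenPartialHomeomorph_coe]
  have hsrc : (0, 0) ∈ e.source := hc.mem_toOpenPartialHomeomorph_source hL one_ne_zero
  have hey : e (0, 0) = y := by rw [hcoe, box_zero_zero]
  have hy : y ∈ e.target := hey ▸ e.map_source hsrc
  have hsy : e.symm y = (0, 0) := by rw [← hey, e.left_inv hsrc]
  have hcs : ContDiffAt ℝ 1 e.symm y := by
    refine e.contDiffAt_symm (f₀' := L) hy ?_ ?_
    · rw [hsy]; exact hL
    · rw [hsy]; exact hc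
  have hS : ContDiffAt ℝ 1 (fun z => (e.symm z).2) y := contDiffAt_snd.comp y hcs
  have hderiv : fderiv ℝ (fun z => (e.symm z).2) y (φ.normal y) = 1 := by
    have h1 := (hS.differentiableAt one_ne_zero).hasFDerivAt
    have h4 : HasDerivAt (fun s : ℝ => y + s • φ.normal y) ((1 : ℝ) • φ.normal y) 0 :=
      ((hasDerivAt_id (0 : ℝ)).smul_const _).const_add _
    have h5 := HasFDerivAt.comp_hasDerivAt (0 : ℝ) (by simpa using h1) h4
    have h6 : (fun z => (e.symm z).2) ∘ (fun s : ℝ => y + s • φ.normal y) =ᶠ[𝓝 0] id := by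
      have hcont : Continuous fun s : ℝ => ((0 : ℝ), s) := by fun_prop
      have : ∀ᶠ s : ℝ in 𝓝 0, ((0 : ℝ), s) ∈ e.source :=
        hcont.continuousAt.eventually_mem (e.open_source.mem_nhds hsrc)
      filter_upwards [this] with s hs
      simp only [Function.comp_apply, id, ← box_zero]
      rw [← hcoe, e.left_inv hs]
    have h7 := h5.congr_of_eventuallyEq h6.symm
    simpa using h7.unique (hasDerivAt_id (0 : ℝ))
  have hev : ∀ᶠ p in 𝓝 y, ContDiffAt ℝ 1 (fun z => (e.symm z).2) p :=
    hS.eventually (by simp)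
  have hfd : ContinuousAt (fun p => fderiv ℝ (fun z => (e.symm z).2) p) y :=
    (hS.fderiv_right (m := 0) (by norm_num)).continuousAt
  have hpos : ∀ᶠ pq : (ℝ × ℝ) × (ℝ × ℝ) in 𝓝 (y, y),
      0 < fderiv ℝ (fun z => (e.symm z).2) pq.1 (φ.normal pq.2) := by
    have hct : ContinuousAt (fun pq : (ℝ × ℝ) × (ℝ × ℝ) =>
        fderiv ℝ (fun z => (e.symm z).2) pq.1 (φ.normal pq.2)) (y, y) := by
      have h1 : ContinuousAt (fun pq : (ℝ × ℝ) × (ℝ × ℝ) =>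
        fderiv ℝ (fun z => (e.symm z).2) pq.1) (y, y) :=
        ContinuousAt.comp (f := Prod.fst) (x := (y, y)) hfd continuousAt_fst
      have h2 : ContinuousAt (fun pq : (ℝ × ℝ) × (ℝ × ℝ) => φ.normal pq.2) (y, y) :=
        (φ.continuous_normal.comp continuous_snd).continuousAt
      exact h1.clm_apply h2
    exact hct.eventually (lt_mem_nhds (by simp [hderiv]))
  rw [nhds_prod_eq] at hpos
  obtain ⟨V, hV, hVp⟩ := (eventually_prod_self_iff (r := fun p q =>
    0 < fderiv ℝ (fun z => (e.symm z).2) p (φ.normal q))).1 hpos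
  refine ⟨e, hcoe, hsrc, V ∩ {p | ContDiffAt ℝ 1 (fun z => (e.symm z).2) p},
    inter_mem hV hev, fun p hp => ⟨ContDiffAt.differentiableAt (n := 1) hp.2 one_ne_zero,
    fun q hq => ?_⟩⟩
  exact hVp p hp.1 q hq.1

end PlaneFlow

namespace PlaneFlow

variable (φ : PlaneFlow)

/-- A measure of the plane invariant under the flow and under integer translations, for which
orbit segments are null. -/
structure Adapted (M : Measure (ℝ × ℝ)) : Prop where
  flow : ∀ t, MeasurePreserving (φ.Φ t) M M
  translate : ∀ k, MeasurePreserving (fun v => v + latticeVec k) M M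
  orbit : ∀ p, M ((fun t => φ.Φ t p) '' Ico 0 1) = 0

variable {φ} {M : Measure (ℝ × ℝ)}

/-- If each orbit issued from `A` spends time `b` in `B` and each backward orbit issued from `B`
spends time `a` in `A`, during a time window of length `2 * R`, then `b * M A = a * M B`. -/
lemma Adapted.mul_measure_eq_mul_measure [IsLocallyFiniteMeasure M] (hM : φ.Adapted M)
    {A B : Set (ℝ × ℝ)} (hA : MeasurableSet A) (hB : MeasurableSet B) {R : ℝ} {a b : ENNReal}
    (hb : ∀ p ∈ A, volume {r | |r| < R ∧ φ.Φ r p ∈ B} = b)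
    (ha : ∀ q ∈ B, volume {r | |r| < R ∧ φ.Φ (-r) q ∈ A} = a) : b * M A = a * M B := by
  have hR : MeasurableSet {r : ℝ | |r| < R} := measurableSet_lt (by fun_prop) (by fun_prop)
  have hΦ : Measurable fun z : ℝ × (ℝ × ℝ) => φ.Φ z.1 z.2 := φ.continuous_uncurry.measurable
  have hΦ' : Measurable fun z : ℝ × (ℝ × ℝ) => φ.Φ (-z.1) z.2 :=
    (φ.continuous_uncurry.comp (by fun_prop : Continuous fun z : ℝ × (ℝ × ℝ) =>
      (-z.1, z.2))).measurable
  set E : Set (ℝ × (ℝ × ℝ)) := {z | |z.1| < R ∧ z.2 ∈ A ∧ φ.Φ z.1 z.2 ∈ B} with hE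
  set E' : Set (ℝ × (ℝ × ℝ)) := {z | |z.1| < R ∧ z.2 ∈ B ∧ φ.Φ (-z.1) z.2 ∈ A} with hE'
  have mE : MeasurableSet E :=
    (measurable_fst hR).inter ((measurable_snd hA).inter (hΦ hB))
  have mE' : MeasurableSet E' :=
    (measurable_fst hR).inter ((measurable_snd hB).inter (hΦ' hA))
  have h1 : (volume.prod M) E = b * M A := by
    rw [Measure.prod_apply_symm mE]
    have : ∀ p, volume ((fun r => (r, p)) ⁻¹' E) = A.indicator (fun _ => b) p := by
      intro p
      by_cases hp : p ∈ A
      · simp only [hE, hp, preimage_ofPred_eq, true_and, indicator_of_mem, hb p hp]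
      · simp [hE, hp]
    simp_rw [this]
    rw [lintegral_indicator hA, setLIntegral_const]
  have h2 : (volume.prod M) E' = a * M B := by
    rw [Measure.prod_apply_symm mE']
    have : ∀ p, volume ((fun r => (r, p)) ⁻¹' E') = B.indicator (fun _ => a) p := by
      intro p
      by_cases hp : p ∈ B
      · simp only [hE', hp, preimage_ofPred_eq, true_and, indicator_of_mem, ha p hp]
      · simp [hE', hp]
    simp_rw [this]
    rw [lintegral_indicator hB, setLIntegral_const]
  rw [← h1, ← h2, Measure.prod_apply mE, Measure.prod_apply mE']
  congr 1
  funext r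
  have h3 := (hM.flow (-r)).measure_preimage (s := Prod.mk r ⁻¹' E)
    (measurable_prodMk_left mE).nullMeasurableSet
  rw [← h3]
  congr 1
  ext q
  simp only [hE, hE', mem_preimage, mem_ofPred_eq, φ.apply_neg]
  tauto

/-- `f` is near `x` a potential of the flux of `M`: it is constant along the flow, and its
increments along the transversal through `x` are the fluxes of `M`. -/
def IsPotentialAt (φ : PlaneFlow) (M : Measure (ℝ × ℝ)) (f : ℝ × ℝ → ℝ) (x : ℝ × ℝ) : Prop :=
  ∃ ε > 0, ∀ s ∈ Ioo (-ε) ε, (∀ t ∈ Ioo (-ε) ε, f (φ.box x (t, s)) = f (φ.box x (0, s))) ∧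
    ∀ s₂ ∈ Ico s ε, ∀ τ ∈ Ioo 0 ε, M.real (φ.box x '' (Ico 0 τ ×ˢ Ico s s₂)) =
      τ * (f (φ.box x (0, s₂)) - f (φ.box x (0, s)))

variable (φ) in
lemma tendsto_box (x : ℝ × ℝ) : Tendsto (φ.box x) (𝓝 (0, 0)) (𝓝 x) := by
  have := (φ.continuous_box x).tendsto (0, 0)
  rwa [box_zero_zero] at this

lemma exists_square_subset {V : Set (ℝ × ℝ)} (hV : V ∈ 𝓝 ((0 : ℝ), (0 : ℝ))) :
    ∃ ε > 0, ∀ t ∈ Ioo (-ε) ε, ∀ s ∈ Ioo (-ε) ε, (t, s) ∈ V := by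
  obtain ⟨ε, hε, h⟩ := Metric.mem_nhds_iff.1 hV
  refine ⟨ε, hε, fun t ht s hs => h ?_⟩
  rw [← ball_prod_same]
  simp only [mem_prod, Real.ball_eq_Ioo, zero_sub, zero_add]
  exact ⟨ht, hs⟩

/-- Flow boxes are neighbourhoods of their centre. -/
lemma box_image_mem_nhds (x : ℝ × ℝ) {V : Set (ℝ × ℝ)} (hV : V ∈ 𝓝 ((0 : ℝ), (0 : ℝ))) :
    φ.box x '' V ∈ 𝓝 x := by
  obtain ⟨e, he, h0, -⟩ := φ.exists_chart x
  have h1 := e.image_mem_nhds h0 hV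
  have h2 : (e : ℝ × ℝ → ℝ × ℝ) = φ.box x := funext he
  rwa [h2, box_zero_zero] at h1

lemma IsPotentialAt.sub_eq {f g : ℝ × ℝ → ℝ} {x : ℝ × ℝ} (hf : φ.IsPotentialAt M f x)
    (hg : φ.IsPotentialAt M g x) : ∀ᶠ z in 𝓝 x, f z - g z = f x - g x := by
  obtain ⟨ε₁, h₁, hf⟩ := hf
  obtain ⟨ε₂, h₂, hg⟩ := hg
  set ε := min ε₁ ε₂ with hε
  have hpos : 0 < ε := lt_min h₁ h₂
  have l₁ : ε ≤ ε₁ := min_le_left _ _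
  have l₂ : ε ≤ ε₂ := min_le_right _ _
  have key : ∀ s ∈ Ioo (-ε) ε, ∀ s₂ ∈ Ico s ε, f (φ.box x (0, s₂)) - f (φ.box x (0, s)) =
      g (φ.box x (0, s₂)) - g (φ.box x (0, s)) := by
    intro s hs s₂ hs₂
    have e₁ := (hf s ⟨by linarith [hs.1], by linarith [hs.2]⟩).2 s₂ ⟨hs₂.1, by linarith [hs₂.2]⟩
      (ε / 2) ⟨by linarith, by linarith⟩
    have e₂ := (hg s ⟨by linarith [hs.1], by linarith [hs.2]⟩).2 s₂ ⟨hs₂.1, by linarith [hs₂.2]⟩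
      (ε / 2) ⟨by linarith, by linarith⟩
    exact mul_left_cancel₀ (by positivity) (e₁.symm.trans e₂)
  have hV : Ioo (-ε) ε ×ˢ Ioo (-ε) ε ∈ 𝓝 ((0 : ℝ), (0 : ℝ)) :=
    prod_mem_nhds (Ioo_mem_nhds (by linarith) hpos) (Ioo_mem_nhds (by linarith) hpos)
  filter_upwards [box_image_mem_nhds x hV] with z hz
  obtain ⟨⟨t, s⟩, ⟨ht, hs⟩, rfl⟩ := hz
  simp only at ht hs
  rw [(hf s ⟨by linarith [hs.1], by linarith [hs.2]⟩).1 t ⟨by linarith [ht.1], by linarith [ht.2]⟩,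
    (hg s ⟨by linarith [hs.1], by linarith [hs.2]⟩).1 t ⟨by linarith [ht.1], by linarith [ht.2]⟩]
  conv_rhs => rw [← φ.box_zero_zero x]
  rcases le_total s 0 with h | h
  · linarith [key s hs 0 ⟨h, hpos⟩]
  · linarith [key 0 ⟨by linarith, hpos⟩ s ⟨h, hs.2⟩]

lemma IsPotentialAt.congr {f g : ℝ × ℝ → ℝ} {x : ℝ × ℝ} (hfg : f =ᶠ[𝓝 x] g)
    (hf : φ.IsPotentialAt M f x) : φ.IsPotentialAt M g x := by
  obtain ⟨ε₁, h₁, hf⟩ := hf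
  obtain ⟨ε₂, h₂, hV⟩ := exists_square_subset ((φ.tendsto_box x).eventually hfg)
  have e : ∀ t ∈ Ioo (-ε₂) ε₂, ∀ s ∈ Ioo (-ε₂) ε₂, f (φ.box x (t, s)) = g (φ.box x (t, s)) := hV
  refine ⟨min ε₁ ε₂, lt_min h₁ h₂, fun s hs => ?_⟩
  rw [← max_neg_neg, mem_Ioo, max_lt_iff, lt_min_iff] at hs
  refine ⟨fun t ht => ?_, fun s₂ hs₂ τ hτ => ?_⟩
  · rw [← max_neg_neg, mem_Ioo, max_lt_iff, lt_min_iff] at ht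
    rw [← e t ⟨ht.1.2, ht.2.2⟩ s ⟨hs.1.2, hs.2.2⟩, ← e 0 ⟨by linarith, h₂⟩ s ⟨hs.1.2, hs.2.2⟩]
    exact (hf s ⟨hs.1.1, hs.2.1⟩).1 t ⟨ht.1.1, ht.2.1⟩
  · rw [mem_Ico, lt_min_iff] at hs₂
    rw [mem_Ioo, lt_min_iff] at hτ
    rw [← e 0 ⟨by linarith, h₂⟩ s ⟨hs.1.2, hs.2.2⟩,
      ← e 0 ⟨by linarith, h₂⟩ s₂ ⟨by linarith, hs₂.2.2⟩]
    exact (hf s ⟨hs.1.1, hs.2.1⟩).2 s₂ ⟨hs₂.1, hs₂.2.1⟩ τ ⟨hτ.1, hτ.2.1⟩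

lemma IsPotentialAt.add_const {f : ℝ × ℝ → ℝ} {x : ℝ × ℝ}
    (hf : φ.IsPotentialAt M f x) (c : ℝ) : φ.IsPotentialAt M (fun z => f z + c) x := by
  obtain ⟨ε, hε, hf⟩ := hf
  refine ⟨ε, hε, fun s hs => ⟨fun t ht => ?_, fun s₂ hs₂ τ hτ => ?_⟩⟩
  · simp only [(hf s hs).1 t ht]
  · rw [(hf s hs).2 s₂ hs₂ τ hτ]; ring

/-- The image of a compact parameter region has finite measure. -/
lemma measure_box_image_ne_top [IsLocallyFiniteMeasure M] (x : ℝ × ℝ) (t₁ t₂ s₁ s₂ : ℝ) :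
    M (φ.box x '' (Ico t₁ t₂ ×ˢ Ico s₁ s₂)) ≠ ⊤ := by
  have h : IsCompact (φ.box x '' (Icc t₁ t₂ ×ˢ Icc s₁ s₂)) :=
    (isCompact_Icc.prod isCompact_Icc).image (φ.continuous_box x)
  exact ((measure_mono (image_mono (Set.prod_mono Ico_subset_Icc_self
    Ico_subset_Icc_self))).trans_lt
    h.measure_lt_top).ne

lemma IsPotentialAt.combine {N : Measure (ℝ × ℝ)} [IsLocallyFiniteMeasure M]
    [IsLocallyFiniteMeasure N] {f g : ℝ × ℝ → ℝ} {x : ℝ × ℝ}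
    (hf : φ.IsPotentialAt M f x) (hg : φ.IsPotentialAt N g x) (a b : NNReal) :
    φ.IsPotentialAt (a • M + b • N) (fun z => a * f z + b * g z) x := by
  obtain ⟨ε₁, h₁, hf⟩ := hf
  obtain ⟨ε₂, h₂, hg⟩ := hg
  refine ⟨min ε₁ ε₂, lt_min h₁ h₂, fun s hs => ?_⟩
  rw [← max_neg_neg, mem_Ioo, max_lt_iff, lt_min_iff] at hs
  have hs1 : s ∈ Ioo (-ε₁) ε₁ := ⟨hs.1.1, hs.2.1⟩
  have hs2 : s ∈ Ioo (-ε₂) ε₂ := ⟨hs.1.2, hs.2.2⟩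
  refine ⟨fun t ht => ?_, fun s₂ hs₂ τ hτ => ?_⟩
  · rw [← max_neg_neg, mem_Ioo, max_lt_iff, lt_min_iff] at ht
    simp only [(hf s hs1).1 t ⟨ht.1.1, ht.2.1⟩, (hg s hs2).1 t ⟨ht.1.2, ht.2.2⟩]
  · rw [mem_Ico, lt_min_iff] at hs₂
    rw [mem_Ioo, lt_min_iff] at hτ
    have e₁ := (hf s hs1).2 s₂ ⟨hs₂.1, hs₂.2.1⟩ τ ⟨hτ.1, hτ.2.1⟩
    have e₂ := (hg s hs2).2 s₂ ⟨hs₂.1, hs₂.2.2⟩ τ ⟨hτ.1, hτ.2.2⟩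
    have n₁ := measure_box_image_ne_top (φ := φ) (M := M) x 0 τ s s₂
    have n₂ := measure_box_image_ne_top (φ := φ) (M := N) x 0 τ s s₂
    simp only [Measure.real, Measure.add_apply, Measure.smul_apply] at e₁ e₂ ⊢
    rw [ENNReal.toReal_add, ENNReal.toReal_smul, ENNReal.toReal_smul, e₁, e₂]
    · simp only [NNReal.smul_def, smul_eq_mul]; ring
    · exact ENNReal.mul_ne_top ENNReal.coe_ne_top n₁
    · exact ENNReal.mul_ne_top ENNReal.coe_ne_top n₂

variable (φ) in
lemma field_add (x : ℝ × ℝ) (k : ℤ × ℤ) : φ.field (x + latticeVec k) = φ.field x := by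
  simp only [field, φ.equivariant, deriv_add_const]

variable (φ) in
lemma box_add (x : ℝ × ℝ) (k : ℤ × ℤ) (p : ℝ × ℝ) :
    φ.box (x + latticeVec k) p = φ.box x p + latticeVec k := by
  simp only [box, normal, field_add, ← φ.equivariant]
  congr 1
  abel

lemma IsPotentialAt.translate (hM : φ.Adapted M) {f : ℝ × ℝ → ℝ} {x : ℝ × ℝ} {k : ℤ × ℤ}
    (hf : φ.IsPotentialAt M f (x + latticeVec k)) :
    φ.IsPotentialAt M (fun z => f (z + latticeVec k)) x := by
  obtain ⟨ε, hε, hf⟩ := hf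
  simp only [box_add] at hf
  refine ⟨ε, hε, fun s hs => ⟨(hf s hs).1, fun s₂ hs₂ τ hτ => ?_⟩⟩
  rw [← (hf s hs).2 s₂ hs₂ τ hτ]
  have h := (hM.translate k).measure_preimage_equiv
    (f := (Homeomorph.addRight (latticeVec k)).toMeasurableEquiv)
    ((fun p => φ.box x p + latticeVec k) '' (Ico 0 τ ×ˢ Ico s s₂))
  rw [Measure.real, Measure.real]
  congr 1
  refine Eq.trans ?_ h
  congr 1
  ext z
  simp [mem_image]

end PlaneFlow

namespace PlaneFlow

variable {φ : PlaneFlow} {M : Measure (ℝ × ℝ)}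

lemma exists_Ioo_of_eventually {P : ℝ → Prop} (h : ∀ᶠ s in 𝓝 (0 : ℝ), P s) :
    ∃ ε > 0, ∀ s ∈ Ioo (-ε) ε, P s := by
  obtain ⟨ε, hε, h⟩ := Metric.eventually_nhds_iff.1 h
  refine ⟨ε, hε, fun s hs => h ?_⟩
  rw [Real.dist_eq, sub_zero]
  exact abs_lt.2 hs

lemma measurableSet_box_image {x : ℝ × ℝ} {K : Set (ℝ × ℝ)} (hK : MeasurableSet K)
    (h : InjOn (φ.box x) K) : MeasurableSet (φ.box x '' K) :=
  hK.image_of_continuousOn_injOn (φ.continuous_box x).continuousOn h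

/-- Potentials exist locally. -/
lemma Adapted.exists_isPotentialAt [IsLocallyFiniteMeasure M] (hM : φ.Adapted M) (y : ℝ × ℝ) :
    ∃ f, ∀ᶠ x in 𝓝 y, φ.IsPotentialAt M f x := by
  obtain ⟨e, he, h0, W, hW, hWp⟩ := φ.exists_chart y
  obtain ⟨ρ, hρ, hsq⟩ := exists_square_subset (e.open_source.mem_nhds h0)
  have inv : ∀ t ∈ Ioo (-ρ) ρ, ∀ s ∈ Ioo (-ρ) ρ, e.symm (φ.box y (t, s)) = (t, s) := by
    intro t ht s hs
    rw [← he, e.left_inv (hsq t ht s hs)]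
  have inj : InjOn (φ.box y) (Ioo (-ρ) ρ ×ˢ Ioo (-ρ) ρ) := by
    rintro ⟨t, s⟩ ⟨ht, hs⟩ ⟨t', s'⟩ ⟨ht', hs'⟩ h
    rw [← inv t ht s hs, h, inv t' ht' s' hs']
  have inj2 : ∀ t s t' s', t ∈ Ioo (-ρ) ρ → s ∈ Ioo (-ρ) ρ → t' ∈ Ioo (-ρ) ρ → s' ∈ Ioo (-ρ) ρ →
      φ.box y (t, s) = φ.box y (t', s') → t = t' ∧ s = s' := fun t s t' s' ht hs ht' hs' h =>
    Prod.mk.inj (inj (mk_mem_prod ht hs) (mk_mem_prod ht' hs') h)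
  set a := ρ / 10 with ha
  have ha0 : 0 < a := by positivity
  have hρa : ρ = 10 * a := by rw [ha]; ring
  set F : ℝ → ℝ := fun s => M.real (φ.box y '' (Ico 0 a ×ˢ Ico (-(ρ / 2)) s)) / a with hF
  have sub : ∀ s₁ s₂, -(ρ / 2) ≤ s₁ → s₂ < ρ →
      Ico 0 a ×ˢ Ico s₁ s₂ ⊆ Ioo (-ρ) ρ ×ˢ Ioo (-ρ) ρ := by
    rintro s₁ s₂ h₁ h₂ ⟨t, s⟩ ⟨ht, hs⟩
    simp only [mem_Ico] at ht hs
    exact ⟨⟨by simp only; linarith, by simp only; linarith⟩,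
      ⟨by simp only; linarith, by simp only; linarith⟩⟩
  have meas : ∀ s₁ s₂, -(ρ / 2) ≤ s₁ → s₂ < ρ →
      MeasurableSet (φ.box y '' (Ico 0 a ×ˢ Ico s₁ s₂)) := fun s₁ s₂ h₁ h₂ =>
    measurableSet_box_image (measurableSet_Ico.prod measurableSet_Ico)
      (inj.mono (sub s₁ s₂ h₁ h₂))
  have hFsub : ∀ s₁ s₂, -(ρ / 2) ≤ s₁ → s₁ ≤ s₂ → s₂ < ρ →
      M.real (φ.box y '' (Ico 0 a ×ˢ Ico s₁ s₂)) = a * (F s₂ - F s₁) := by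
    intro s₁ s₂ h₁ h₁₂ h₂
    have hun : φ.box y '' (Ico 0 a ×ˢ Ico (-(ρ / 2)) s₂) =
        φ.box y '' (Ico 0 a ×ˢ Ico (-(ρ / 2)) s₁) ∪ φ.box y '' (Ico 0 a ×ˢ Ico s₁ s₂) := by
      rw [← image_union, ← prod_union, Ico_union_Ico_eq_Ico h₁ h₁₂]
    have hdis : Disjoint (φ.box y '' (Ico 0 a ×ˢ Ico (-(ρ / 2)) s₁))
        (φ.box y '' (Ico 0 a ×ˢ Ico s₁ s₂)) := by
      rw [Set.disjoint_left]
      rintro _ ⟨z, hz, rfl⟩ ⟨z', hz', h⟩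
      have h := inj (sub _ _ h₁ h₂ hz') (sub _ _ le_rfl (by linarith) hz) h
      subst h
      exact absurd hz.2.2 (not_lt.2 hz'.2.1)
    have := measureReal_union (μ := M) hdis (meas s₁ s₂ h₁ h₂)
      (measure_box_image_ne_top _ _ _ _ _) (measure_box_image_ne_top _ _ _ _ _)
    simp only [hF]
    rw [hun, this]
    field_simp
    ring
  refine ⟨fun z => F (e.symm z).2, ?_⟩
  have hV : Ioo (-a) a ×ˢ Ioo (-a) a ∈ 𝓝 ((0 : ℝ), (0 : ℝ)) :=
    prod_mem_nhds (Ioo_mem_nhds (by linarith) ha0) (Ioo_mem_nhds (by linarith) ha0)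
  filter_upwards [box_image_mem_nhds y hV, eventually_mem_nhds_iff.2 hW] with x hx hxW
  obtain ⟨⟨t₀, s₀⟩, ⟨ht₀, hs₀⟩, rfl⟩ := hx
  simp only at ht₀ hs₀
  have large : ∀ t ∈ Ioo (-a) a, t ∈ Ioo (-ρ) ρ := fun t ht =>
    ⟨by linarith [ht.1], by linarith [ht.2]⟩
  set x := φ.box y (t₀, s₀) with hx
  have hxt : x ∈ e.target := by
    rw [hx, ← he]; exact e.map_source (hsq _ (large _ ht₀) _ (large _ hs₀))
  have line : Continuous fun s : ℝ => x + s • φ.normal x := by fun_prop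
  have line0 : Tendsto (fun s : ℝ => x + s • φ.normal x) (𝓝 0) (𝓝 x) := by
    simpa using line.tendsto 0
  obtain ⟨ε₁, hε₁, hev⟩ := exists_Ioo_of_eventually (
    (line0.eventually (e.open_target.mem_nhds hxt)).and ((line0.eventually hxW).and
      (line0.eventually ((e.continuousAt_symm hxt).eventually_mem
        (s := Ioo (-a) a ×ˢ Ioo (-a) a) (by
          rw [hx, inv _ (large _ ht₀) _ (large _ hs₀)]
          exact prod_mem_nhds (Ioo_mem_nhds ht₀.1 ht₀.2) (Ioo_mem_nhds hs₀.1 hs₀.2))))))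
  set ε := min ε₁ a with hε
  have hε0 : 0 < ε := lt_min hε₁ ha0
  have hεa : ε ≤ a := min_le_right _ _
  replace hev : ∀ s ∈ Ioo (-ε) ε, _ := fun s hs =>
    hev s ⟨by linarith [hs.1, min_le_left ε₁ a], by linarith [hs.2, min_le_left ε₁ a]⟩
  set θ : ℝ → ℝ := fun s => (e.symm (x + s • φ.normal x)).1 with hθ
  set κ : ℝ → ℝ := fun s => (e.symm (x + s • φ.normal x)).2 with hκ
  have hθa : ∀ s ∈ Ioo (-ε) ε, θ s ∈ Ioo (-a) a := fun s hs => (hev s hs).2.2.1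
  have hκa : ∀ s ∈ Ioo (-ε) ε, κ s ∈ Ioo (-a) a := fun s hs => (hev s hs).2.2.2
  have coord : ∀ s ∈ Ioo (-ε) ε, ∀ t, φ.box x (t, s) = φ.box y (t + θ s, κ s) := by
    intro s hs t
    have h1 : φ.box y (θ s, κ s) = x + s • φ.normal x := by
      rw [← he]; exact e.right_inv (hev s hs).1
    have h2 := φ.flow_box y t (θ s, κ s)
    rw [h1] at h2
    exact h2
  have hderiv : ∀ s ∈ Ioo (-ε) ε, HasDerivAt κ
      (fderiv ℝ (fun z => (e.symm z).2) (x + s • φ.normal x) (φ.normal x)) s := by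
    intro s hs
    have h4 : HasDerivAt (fun s : ℝ => x + s • φ.normal x) ((1 : ℝ) • φ.normal x) s :=
      ((hasDerivAt_id s).smul_const _).const_add _
    rw [one_smul] at h4
    exact HasFDerivAt.comp_hasDerivAt (f := fun s : ℝ => x + s • φ.normal x)
      (l := fun z => (e.symm z).2) s (hWp _ (hev s hs).2.1).1.hasFDerivAt h4
  have hcont : ContinuousOn κ (Ioo (-ε) ε) := fun s hs =>
    (hderiv s hs).continuousAt.continuousWithinAt
  have hmono : StrictMonoOn κ (Ioo (-ε) ε) := by
    refine strictMonoOn_of_deriv_pos (convex_Ioo _ _) hcont fun s hs => ?_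
    rw [interior_Ioo] at hs
    rw [(hderiv s hs).deriv]
    exact (hWp _ (hev s hs).2.1).2 x (mem_of_mem_nhds hxW)
  have hval : ∀ s ∈ Ioo (-ε) ε, (e.symm (φ.box x (0, s))).2 = κ s := by
    intro s hs
    rw [coord s hs, inv _ (by rw [zero_add]; exact large _ (hθa s hs)) _ (large _ (hκa s hs))]
  clear_value θ κ
  refine ⟨ε, hε0, fun s₁ hs₁ => ⟨fun t ht => ?_, fun s₂ hs₂ τ hτ => ?_⟩⟩
  · have h1 := hθa s₁ hs₁
    have h2 := large _ (hκa s₁ hs₁)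
    simp only
    rw [coord s₁ hs₁, coord s₁ hs₁, inv _ ⟨by linarith [ht.1, h1.1], by linarith [ht.2, h1.2]⟩ _ h2,
      inv _ ⟨by linarith [h1.1], by linarith [h1.2]⟩ _ h2]
  have hs₂' : s₂ ∈ Ioo (-ε) ε := ⟨by linarith [hs₁.1, hs₂.1], hs₂.2⟩
  have hκ₁ := hκa s₁ hs₁
  have hκ₂ := hκa s₂ hs₂'
  simp only [hval s₁ hs₁, hval s₂ hs₂']
  have mid : ∀ s ∈ Ico s₁ s₂, s ∈ Ioo (-ε) ε := fun s hs =>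
    ⟨by linarith [hs₁.1, hs.1], by linarith [hs₂.2, hs.2]⟩
  have hκ₁₂ : κ s₁ ≤ κ s₂ := hmono.monotoneOn hs₁ hs₂' hs₂.1
  have injx : InjOn (φ.box x) (Ico 0 τ ×ˢ Ico s₁ s₂) := by
    rintro ⟨t, s⟩ ⟨ht, hs⟩ ⟨t', s'⟩ ⟨ht', hs'⟩ h
    simp only [mem_Ico] at ht ht'
    have b := hθa s (mid s hs)
    have b' := hθa s' (mid s' hs')
    rw [coord s (mid s hs), coord s' (mid s' hs')] at h
    have h := inj2 _ _ _ _ ⟨by linarith [b.1], by linarith [b.2, hτ.2]⟩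
      (large _ (hκa s (mid s hs))) ⟨by linarith [b'.1], by linarith [b'.2, hτ.2]⟩
      (large _ (hκa s' (mid s' hs'))) h
    have hss : s = s' := hmono.injOn (mid s hs) (mid s' hs') h.2
    subst hss
    exact Prod.ext (by simpa using h.1) rfl
  have measA : MeasurableSet (φ.box x '' (Ico 0 τ ×ˢ Ico s₁ s₂)) :=
    measurableSet_box_image (measurableSet_Ico.prod measurableSet_Ico) injx
  have swap := hM.mul_measure_eq_mul_measure (R := 5 * a) (a := ENNReal.ofReal τ)
    (b := ENNReal.ofReal a) measA
    (meas (κ s₁) (κ s₂) (by linarith [hκ₁.1]) (by linarith [hκ₂.2])) ?_ ?_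
  · have h1 := congrArg ENNReal.toReal swap
    rw [ENNReal.toReal_mul, ENNReal.toReal_mul, ENNReal.toReal_ofReal hτ.1.le,
      ENNReal.toReal_ofReal ha0.le] at h1
    have h2 := hFsub (κ s₁) (κ s₂) (by linarith [hκ₁.1]) hκ₁₂ (by linarith [hκ₂.2])
    simp only [Measure.real] at h2 ⊢
    rw [h2] at h1
    refine mul_left_cancel₀ ha0.ne' (h1.trans ?_)
    ring
  · rintro _ ⟨⟨t, s⟩, ⟨ht, hs⟩, rfl⟩
    simp only [mem_Ico] at ht
    have b := hθa s (mid s hs)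
    have c := hκa s (mid s hs)
    have : {r | |r| < 5 * a ∧ φ.Φ r (φ.box x (t, s)) ∈ φ.box y '' (Ico 0 a ×ˢ Ico (κ s₁) (κ s₂))} =
        Ico (-(t + θ s)) (a - (t + θ s)) := by
      ext r
      simp only [mem_ofPred_eq, flow_box]
      rw [coord s (mid s hs)]
      constructor
      · rintro ⟨hr, ⟨t', s'⟩, ⟨ht', hs'⟩, h⟩
        rw [abs_lt] at hr
        simp only [mem_Ico] at ht' hs'
        have h := inj2 _ _ _ _ ⟨by linarith, by linarith⟩
          ⟨by linarith [hκ₁.1], by linarith [hκ₂.2]⟩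
          ⟨by linarith [b.1], by linarith [b.2, hτ.2]⟩ (large _ c) h
        exact ⟨by linarith, by linarith⟩
      · rintro ⟨hr1, hr2⟩
        refine ⟨abs_lt.2 ⟨by linarith [b.2, hτ.2], by linarith [b.1]⟩,
          (r + t + θ s, κ s), ⟨⟨by simp only; linarith, by simp only; linarith⟩, ?_, ?_⟩, rfl⟩
        · exact hmono.monotoneOn hs₁ (mid s hs) hs.1
        · exact hmono (mid s hs) hs₂' hs.2
    rw [this, Real.volume_Ico]
    congr 1
    ring
  · rintro _ ⟨⟨t', s'⟩, ⟨ht', hs'⟩, rfl⟩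
    simp only [mem_Ico] at ht'
    obtain ⟨s, hs, hss'⟩ : ∃ s ∈ Ico s₁ s₂, κ s = s' := by
      obtain ⟨s, hs, h⟩ := intermediate_value_Icc hs₂.1
        (hcont.mono fun s hs => ⟨by linarith [hs₁.1, hs.1], by linarith [hs₂.2, hs.2]⟩)
        (Ico_subset_Icc_self hs')
      refine ⟨s, ⟨hs.1, lt_of_le_of_ne hs.2 ?_⟩, h⟩
      rintro rfl
      exact absurd hs'.2 (by simp [h])
    subst hss'
    have b := hθa s (mid s hs)
    have c := hκa s (mid s hs)
    have : {r | |r| < 5 * a ∧ φ.Φ (-r) (φ.box y (t', κ s)) ∈ φ.box x '' (Ico 0 τ ×ˢ Ico s₁ s₂)} =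
        Ioc (t' - θ s - τ) (t' - θ s) := by
      ext r
      simp only [mem_ofPred_eq, flow_box]
      constructor
      · rintro ⟨hr, ⟨t, s''⟩, ⟨ht, hs''⟩, h⟩
        rw [abs_lt] at hr
        simp only [mem_Ico] at ht
        have b'' := hθa s'' (mid s'' hs'')
        rw [coord s'' (mid s'' hs'')] at h
        have h := inj2 _ _ _ _ ⟨by linarith [b''.1], by linarith [b''.2, hτ.2]⟩
          (large _ (hκa s'' (mid s'' hs''))) ⟨by linarith, by linarith⟩ (large _ c) h
        have hss : s'' = s := hmono.injOn (mid s'' hs'') (mid s hs) h.2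
        subst hss
        exact ⟨by linarith, by linarith⟩
      · rintro ⟨hr1, hr2⟩
        refine ⟨abs_lt.2 ⟨by linarith [b.2, hτ.2], by linarith [b.1]⟩,
          (t' - θ s - r, s), ⟨⟨by simp only; linarith, by simp only; linarith⟩, hs⟩, ?_⟩
        rw [coord s (mid s hs)]
        congr 2
        ring
    rw [this, Real.volume_Ioc]
    congr 1
    ring

end PlaneFlow

/-- A property of germs of functions that determines them up to additive constants. -/
structure IsPotentialProperty {E : Type*} [TopologicalSpace E] (P : (E → ℝ) → E → Prop) :
    Prop where
  sub_eq : ∀ {f g x}, P f x → P g x → ∀ᶠ z in 𝓝 x, f z - g z = f x - g x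
  congr : ∀ {f g x}, f =ᶠ[𝓝 x] g → P f x → P g x
  add_const : ∀ {f x} c, P f x → P (fun z => f z + c) x

namespace IsPotentialProperty

variable {E : Type*} [NormedAddCommGroup E] [NormedSpace ℝ E] {P : (E → ℝ) → E → Prop}

lemma sub_eq_sub (hP : IsPotentialProperty P) {U : Set E} (hU : Convex ℝ U) {f g : E → ℝ}
    (hf : ∀ x ∈ U, P f x) (hg : ∀ x ∈ U, P g x) {v w : E} (hv : v ∈ U) (hw : w ∈ U) :
    f w - f v = g w - g v := by
  have h : IsLocallyConstant fun x : U => f x - g x := by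
    rw [IsLocallyConstant.iff_eventually_eq]
    intro x
    exact continuous_subtype_val.continuousAt.eventually (hP.sub_eq (hf x x.2) (hg x x.2))
  have : PreconnectedSpace U := isPreconnected_iff_preconnectedSpace.1 hU.isPreconnected
  have := h.apply_eq_of_preconnectedSpace ⟨v, hv⟩ ⟨w, hw⟩
  simp only at this
  linarith

lemma exists_on_ball [ProperSpace E] (hP : IsPotentialProperty P)
    (hloc : ∀ y, ∃ f, ∀ᶠ x in 𝓝 y, P f x) (R : ℝ) : ∃ H, ∀ x ∈ Metric.ball (0 : E) R, P H x := by
  choose f hf using hloc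
  obtain ⟨δ, hδ, hleb⟩ := lebesgue_number_lemma_of_metric (isCompact_closedBall (0 : E) R)
    (c := fun y => interior {x | P (f y) x}) (fun _ => isOpen_interior)
    (fun y _ => mem_iUnion.2 ⟨y, mem_interior_iff_mem_nhds.2 (hf y)⟩)
  have hleb' : ∀ x, ∃ g, x ∈ Metric.closedBall (0 : E) R → ∀ z ∈ Metric.ball x δ, P g z := by
    intro x
    by_cases hx : x ∈ Metric.closedBall (0 : E) R
    · obtain ⟨i, hi⟩ := hleb x hx
      exact ⟨f i, fun _ z hz => interior_subset (hi hz)⟩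
    · exact ⟨0, fun h => absurd h hx⟩
  choose g hg using hleb'
  obtain ⟨N, hN⟩ := exists_nat_gt (max (R / (δ / 4)) 0)
  have hN0 : (0 : ℝ) < N := (le_max_right _ _).trans_lt hN
  have hRN : R / N < δ / 4 := by
    rw [div_lt_iff₀ hN0]
    have := (le_max_left _ _).trans_lt hN
    rw [div_lt_iff₀ (by positivity)] at this
    linarith
  set a : ℕ → E → E := fun k v => ((k : ℝ) / N) • v with ha
  have a_zero : ∀ v, a 0 v = 0 := fun v => by simp [ha]
  have a_top : ∀ v, a N v = v := fun v => by simp [ha, hN0.ne']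
  have a_norm : ∀ k ≤ N, ∀ v, ‖a k v‖ ≤ ‖v‖ := by
    intro k hk v
    rw [ha, norm_smul, Real.norm_of_nonneg (by positivity)]
    refine mul_le_of_le_one_left (norm_nonneg _) ((div_le_one hN0).2 (by exact_mod_cast hk))
  have a_sub : ∀ k ≤ N, ∀ v w, dist (a k v) (a k w) ≤ dist v w := by
    intro k hk v w
    have := a_norm k hk (v - w)
    simp only [ha] at this ⊢
    rwa [smul_sub, ← dist_eq_norm, ← dist_eq_norm] at this
  have a_succ : ∀ k, ∀ v ∈ Metric.ball (0 : E) R, dist (a (k + 1) v) (a k v) < δ / 4 := by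
    intro k v hv
    rw [mem_ball_zero_iff] at hv
    rw [dist_eq_norm]
    have : a (k + 1) v - a k v = (1 / N : ℝ) • v := by
      simp only [ha]
      rw [← sub_smul]
      congr 1
      push_cast
      ring
    rw [this, norm_smul, Real.norm_of_nonneg (by positivity)]
    refine lt_of_le_of_lt ?_ hRN
    rw [one_div, inv_mul_eq_div]
    gcongr
  have mem : ∀ k ≤ N, ∀ v ∈ Metric.ball (0 : E) R, a k v ∈ Metric.closedBall (0 : E) R := by
    intro k hk v hv
    rw [mem_ball_zero_iff] at hv
    rw [mem_closedBall_zero_iff]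
    exact (a_norm k hk v).trans hv.le
  have conv : ∀ p ∈ Metric.closedBall (0 : E) R, ∀ q ∈ Metric.closedBall (0 : E) R, ∀ v w,
      dist v p < δ → dist v q < δ → dist w p < δ → dist w q < δ →
      g p w - g p v = g q w - g q v := fun p hp q hq v w h1 h2 h3 h4 =>
    hP.sub_eq_sub ((convex_ball p δ).inter (convex_ball q δ)) (fun x hx => hg p hp x hx.1)
      (fun x hx => hg q hq x hx.2) ⟨h1, h2⟩ ⟨h3, h4⟩
  refine ⟨fun v => ∑ k ∈ Finset.range N, (g (a k v) (a (k + 1) v) - g (a k v) (a k v)),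
    fun x hx => ?_⟩
  have hxR := mem_ball_zero_iff.1 hx
  refine hP.congr ?_ (hP.add_const
    (∑ k ∈ Finset.range N, (g (a k x) (a (k + 1) x) - g (a k x) (a k x)) - g x x)
    (hg x (Metric.ball_subset_closedBall hx) x (Metric.mem_ball_self hδ)))
  filter_upwards [Metric.ball_mem_nhds x (by positivity : 0 < δ / 4),
    Metric.isOpen_ball.mem_nhds hx] with w hw hwR
  rw [Metric.mem_ball] at hw
  have main : ∀ k < N, (g (a k w) (a (k + 1) w) - g (a k w) (a k w)) -
      (g (a k x) (a (k + 1) x) - g (a k x) (a k x)) =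
      (g (a (k + 1) x) (a (k + 1) w) - g (a (k + 1) x) (a (k + 1) x)) -
      (g (a k x) (a k w) - g (a k x) (a k x)) := by
    intro k hk
    have d1 := a_sub k hk.le w x
    have d2 := a_sub (k + 1) hk w x
    have d3 := a_succ k w hwR
    have d4 := a_succ k x hx
    have d5 : dist (a (k + 1) w) (a k x) ≤ _ := dist_triangle _ (a (k + 1) x) _
    have e1 := conv _ (mem k hk.le w hwR) _ (mem k hk.le x hx) (a k w) (a (k + 1) w)
      (by simpa using hδ) (by linarith) (by linarith) (by linarith)
    have e2 := conv _ (mem (k + 1) hk x hx) _ (mem k hk.le x hx) (a (k + 1) x) (a (k + 1) w)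
      (by simpa using hδ) (by linarith) (by linarith) (by linarith)
    linarith
  have tele := Finset.sum_range_sub (fun k => g (a k x) (a k w) - g (a k x) (a k x)) N
  rw [← Finset.sum_congr rfl fun k hk => main k (Finset.mem_range.1 hk),
    Finset.sum_sub_distrib, a_top, a_top, a_zero, a_zero] at tele
  linarith

lemma exists_global [ProperSpace E] (hP : IsPotentialProperty P)
    (hloc : ∀ y, ∃ f, ∀ᶠ x in 𝓝 y, P f x) : ∃ H, ∀ x : E, P H x := by
  choose H hH using fun n : ℕ => hP.exists_on_ball hloc ((n : ℝ) + 1)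
  refine ⟨fun v => H ⌈‖v‖⌉₊ v - H ⌈‖v‖⌉₊ 0, fun x => ?_⟩
  set m := ⌈‖x‖⌉₊ + 1 with hm
  have hxm : ‖x‖ < m := by
    have := Nat.le_ceil ‖x‖
    rw [hm]; push_cast; linarith
  refine hP.congr ?_ (hP.add_const (-(H m 0)) (hH m x (by rw [mem_ball_zero_iff]; linarith)))
  filter_upwards [Metric.isOpen_ball.mem_nhds (mem_ball_zero_iff.2 hxm)] with v hv
  rw [mem_ball_zero_iff] at hv
  have hnm : ⌈‖v‖⌉₊ ≤ m := Nat.ceil_le.2 hv.le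
  have hnm' : (⌈‖v‖⌉₊ : ℝ) ≤ m := by exact_mod_cast hnm
  have := hP.sub_eq_sub (convex_ball (0 : E) (⌈‖v‖⌉₊ + 1)) (hH ⌈‖v‖⌉₊)
    (fun x hx => hH m x (Metric.ball_subset_ball (by linarith) hx))
    (Metric.mem_ball_self (by positivity))
    (mem_ball_zero_iff.2 (by linarith [Nat.le_ceil ‖v‖] : ‖v‖ < ⌈‖v‖⌉₊ + 1))
  linarith

end IsPotentialProperty

namespace PlaneFlow

variable {φ : PlaneFlow} {M : Measure (ℝ × ℝ)}

lemma isPotentialProperty : IsPotentialProperty (φ.IsPotentialAt M) where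
  sub_eq := IsPotentialAt.sub_eq
  congr := IsPotentialAt.congr
  add_const := fun c h => h.add_const c

lemma Adapted.exists_potential [IsLocallyFiniteMeasure M] (hM : φ.Adapted M) :
    ∃ H, ∀ x, φ.IsPotentialAt M H x :=
  isPotentialProperty.exists_global hM.exists_isPotentialAt

end PlaneFlow

namespace PlaneFlow

variable {φ : PlaneFlow} {M : Measure (ℝ × ℝ)} {H : ℝ × ℝ → ℝ}

lemma box_fst_zero (x : ℝ × ℝ) (t : ℝ) : φ.box x (t, 0) = φ.Φ t x := by
  simp [box]

lemma apply_of_isPotentialAt (hH : ∀ x, φ.IsPotentialAt M H x) (t : ℝ) (v : ℝ × ℝ) :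
    H (φ.Φ t v) = H v := by
  have h : IsLocallyConstant fun t => H (φ.Φ t v) := by
    rw [IsLocallyConstant.iff_eventually_eq]
    intro t
    obtain ⟨ε, hε, h⟩ := hH (φ.Φ t v)
    filter_upwards [Ioo_mem_nhds (sub_lt_self t hε) (lt_add_of_pos_right t hε)] with r hr
    have h1 := (h 0 ⟨by linarith, hε⟩).1 (r - t) ⟨by linarith [hr.1], by linarith [hr.2]⟩
    rw [box_fst_zero, box_fst_zero, φ.zero, ← φ.add, sub_add_cancel] at h1
    exact h1
  have := h.apply_eq_of_preconnectedSpace t 0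
  rwa [φ.zero] at this

lemma apply_add_of_isPotentialAt (hM : φ.Adapted M) (hH : ∀ x, φ.IsPotentialAt M H x)
    (v : ℝ × ℝ) (k : ℤ × ℤ) :
    H (v + latticeVec k) = H v + (H (latticeVec k) - H 0) := by
  have := isPotentialProperty.sub_eq_sub (P := φ.IsPotentialAt M) convex_univ
    (f := fun z => H (z + latticeVec k)) (g := H) (fun x _ => (hH _).translate hM) (fun x _ => hH x)
    (mem_univ 0) (mem_univ v)
  simp only [zero_add] at this
  linarith

lemma exists_periods (hM : φ.Adapted M) (hH : ∀ x, φ.IsPotentialAt M H x) :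
    ∃ α β : ℝ, ∀ v k, H (v + latticeVec k) = H v + (k.1 * α + k.2 * β) := by
  let c : ℤ × ℤ →+ ℝ :=
    { toFun := fun k => H (latticeVec k) - H 0
      map_zero' := by simp [latticeVec, ← Prod.mk_zero_zero]
      map_add' := fun k l => by
        rw [latticeVec_add, apply_add_of_isPotentialAt hM hH]; ring }
  refine ⟨c (1, 0), c (0, 1), fun v k => ?_⟩
  rw [apply_add_of_isPotentialAt hM hH v k]
  congr 1
  change c k = _
  have : k = k.1 • (1, 0) + k.2 • (0, 1) := by ext <;> simp
  rw [this, map_add, map_zsmul, map_zsmul]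
  simp

lemma IsPotentialAt.continuousAt [IsLocallyFiniteMeasure M] (hM : φ.Adapted M) {x : ℝ × ℝ}
    (hH : φ.IsPotentialAt M H x) : ContinuousAt H x := by
  obtain ⟨ε, hε, h⟩ := hH
  set τ := min ε 1 / 2 with hτ
  have hτ0 : 0 < τ := by positivity
  have hτε : τ < ε := by linarith [min_le_left ε 1]
  have hτ1 : τ < 1 := by linarith [min_le_right ε 1]
  have hmono : ∀ s ∈ Ioo (-ε) ε, ∀ s₂ ∈ Ico s ε, H (φ.box x (0, s)) ≤ H (φ.box x (0, s₂)) := by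
    intro s hs s₂ hs₂
    have h1 := (h s hs).2 s₂ hs₂ τ ⟨hτ0, hτε⟩
    have h2 := nonneg_of_mul_nonneg_right (h1 ▸ measureReal_nonneg : 0 ≤ τ * _) hτ0
    linarith
  rw [Metric.continuousAt_iff']
  intro η hη
  have hnull : M (φ.box x '' (Icc 0 τ ×ˢ {0})) < ENNReal.ofReal (τ * η) := by
    refine lt_of_le_of_lt (le_of_eq ?_) (ENNReal.ofReal_pos.2 (by positivity))
    refine measure_mono_null ?_ (hM.orbit x)
    rintro _ ⟨⟨t, s⟩, ⟨ht, rfl⟩, rfl⟩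
    exact ⟨t, ⟨ht.1, ht.2.trans_lt hτ1⟩, (box_fst_zero x t).symm⟩
  obtain ⟨U, hKU, hU, hMU⟩ := Set.exists_isOpen_lt_of_lt _ _ hnull
  obtain ⟨u, v, hu, hv, hKu, hv0, huv⟩ := generalized_tube_lemma (isCompact_Icc (a := 0) (b := τ))
    (isCompact_singleton (x := (0 : ℝ))) (hU.preimage (φ.continuous_box x))
    (image_subset_iff.1 hKU)
  obtain ⟨σ, hσ, hσv⟩ := exists_Ioo_of_eventually (hv.mem_nhds (hv0 rfl))
  set r := min σ ε / 2 with hr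
  have hr0 : 0 < r := by positivity
  have hrσ : r < σ := by linarith [min_le_left σ ε]
  have hrε : r < ε := by linarith [min_le_right σ ε]
  have hsmall : H (φ.box x (0, r)) - H (φ.box x (0, -r)) < η := by
    have h1 := (h (-r) ⟨by linarith, by linarith⟩).2 r ⟨by linarith, hrε⟩ τ ⟨hτ0, hτε⟩
    have h2 : M.real (φ.box x '' (Ico 0 τ ×ˢ Ico (-r) r)) < τ * η := by
      rw [Measure.real, ← ENNReal.lt_ofReal_iff_toReal_lt (measure_box_image_ne_top _ _ _ _ _)]
      refine lt_of_le_of_lt (measure_mono (image_subset_iff.2 ?_)) hMU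
      rintro ⟨t, s⟩ ⟨ht, hs⟩
      exact huv ⟨hKu (Ico_subset_Icc_self ht), hσv s ⟨by linarith [hs.1], hs.2.trans hrσ⟩⟩
    rw [h1] at h2
    exact lt_of_mul_lt_mul_left h2 hτ0.le
  have hV : Ioo (-r) r ×ˢ Ioo (-r) r ∈ 𝓝 ((0 : ℝ), (0 : ℝ)) :=
    prod_mem_nhds (Ioo_mem_nhds (by linarith) hr0) (Ioo_mem_nhds (by linarith) hr0)
  filter_upwards [box_image_mem_nhds x hV] with z hz
  obtain ⟨⟨t, s⟩, ⟨ht, hs⟩, rfl⟩ := hz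
  simp only at ht hs
  rw [(h s ⟨by linarith [hs.1], by linarith [hs.2]⟩).1 t ⟨by linarith [ht.1], by linarith [ht.2]⟩]
  have l1 := hmono (-r) ⟨by linarith, by linarith⟩ s ⟨hs.1.le, by linarith [hs.2]⟩
  have l2 := hmono s ⟨by linarith [hs.1], by linarith [hs.2]⟩ r ⟨hs.2.le, hrε⟩
  have l3 := hmono (-r) ⟨by linarith, by linarith⟩ 0 ⟨by linarith, hε⟩
  have l4 := hmono 0 ⟨by linarith, hε⟩ r ⟨hr0.le, hrε⟩
  rw [box_zero_zero] at l3 l4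
  rw [Real.dist_eq, abs_lt]
  constructor <;> linarith

lemma Adapted.continuous_potential [IsLocallyFiniteMeasure M] (hM : φ.Adapted M)
    (hH : ∀ x, φ.IsPotentialAt M H x) : Continuous H :=
  continuous_iff_continuousAt.2 fun x => (hH x).continuousAt hM

end PlaneFlow

/-- A Lipschitz function whose derivative vanishes almost everywhere on an interval is constant
there. -/
lemma LipschitzWith.eq_of_deriv_ae_eq_zero {g : ℝ → ℝ} {K : NNReal} (hg : LipschitzWith K g)
    {A B : ℝ} (hAB : A ≤ B) (h : volume ({y | deriv g y ≠ 0} ∩ Ico A B) = 0) :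
    ∀ y ∈ Icc A B, g y = g A := by
  have hac : AbsolutelyContinuousOnInterval g A B :=
    (hg.lipschitzOnWith).absolutelyContinuousOnInterval
  obtain ⟨c, hc⟩ := hac.const_of_ae_hasDerivAt_zero (by
    have h1 : ∀ᵐ y : ℝ, y ∉ {y | deriv g y ≠ 0} ∩ Ico A B := measure_eq_zero_iff_ae_notMem.1 h
    have h2 : ∀ᵐ y : ℝ, y ∉ ({B} : Set ℝ) := measure_eq_zero_iff_ae_notMem.1 (by simp)
    filter_upwards [h1, h2, hg.ae_differentiableAt_real] with y h1 h2 h3 hy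
    rw [uIcc_of_le hAB] at hy
    have : deriv g y = 0 := by
      by_contra hne
      exact h1 ⟨hne, hy.1, lt_of_le_of_ne hy.2 h2⟩
    rw [← this]
    exact h3.hasDerivAt)
  rw [uIcc_of_le hAB] at hc
  intro y hy
  rw [hc y hy, hc A (left_mem_Icc.2 hAB)]

/-- If `G` varies less than the monotone function `F`, and if `dF`-almost every point is an
accumulation point of its level set for `G`, then `G` is constant. -/
lemma eq_of_frequently_eq {F G : ℝ → ℝ} {a b : ℝ} (hab : a ≤ b) (hF : Continuous F)
    (hFG : ∀ s ∈ Icc a b, ∀ s' ∈ Icc a b, s ≤ s' → |G s' - G s| ≤ F s' - F s)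
    (hD : ∀ D, MeasurableSet D →
      (∀ s ∈ Ico a b, F s ∈ D → ¬ ∃ᶠ s' in 𝓝[≠] s, G s' = G s) →
      volume (D ∩ Ico (F a) (F b)) = 0) :
    ∀ s ∈ Icc a b, G s = G a := by
  have hmono : MonotoneOn F (Icc a b) := fun s hs s' hs' hss' => by
    linarith [abs_nonneg (G s' - G s), hFG s hs s' hs' hss']
  have hdist : ∀ s ∈ Icc a b, ∀ s' ∈ Icc a b, |G s' - G s| ≤ |F s' - F s| := by
    intro s hs s' hs'
    rcases le_total s s' with h | h
    · exact (hFG s hs s' hs' h).trans (le_abs_self _)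
    · rw [abs_sub_comm, abs_sub_comm (F s')]
      exact (hFG s' hs' s hs h).trans (le_abs_self _)
  obtain ⟨g, hg, hgF⟩ : ∃ g : ℝ → ℝ, LipschitzWith 1 g ∧ ∀ s ∈ Icc a b, g (F s) = G s := by
    set i := Function.invFunOn F (Icc a b) with hi
    have hmem : ∀ s ∈ Icc a b, i (F s) ∈ Icc a b := fun s hs =>
      Function.invFunOn_mem ⟨s, hs, rfl⟩
    have heq : ∀ s ∈ Icc a b, F (i (F s)) = F s := fun s hs =>
      Function.invFunOn_eq ⟨s, hs, rfl⟩
    have hl : LipschitzOnWith 1 (fun y => G (i y)) (F '' Icc a b) := by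
      refine LipschitzOnWith.of_dist_le_mul ?_
      rintro _ ⟨s, hs, rfl⟩ _ ⟨s', hs', rfl⟩
      rw [Real.dist_eq, Real.dist_eq, NNReal.coe_one, one_mul, ← heq s hs, ← heq s' hs',
        heq s hs, heq s' hs']
      have := hdist _ (hmem s' hs') _ (hmem s hs)
      rwa [heq s hs, heq s' hs'] at this
    obtain ⟨g, hg, hge⟩ := hl.extend_real
    refine ⟨g, hg, fun s hs => ?_⟩
    rw [← hge ⟨s, hs, rfl⟩]
    have := hdist _ hs _ (hmem s hs)
    rw [heq s hs, sub_self, abs_zero] at this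
    linarith [abs_nonpos_iff.1 this]
  set C : Set ℝ :=
    {c | ∃ x y, x ∈ Icc a b ∧ y ∈ Icc a b ∧ x < y ∧ F x = c ∧ F y = c} ∪ {F a} with hC
  have hCc : C.Countable :=
    hmono.countable_setOfPred_two_preimages.union (countable_singleton _)
  have hderiv : MeasurableSet {y | deriv g y ≠ 0} :=
    (measurableSet_eq_fun (measurable_deriv g) measurable_const).compl
  have hvol := hD ({y | deriv g y ≠ 0} \ C) (hderiv.diff hCc.measurableSet) (by
    rintro s hs ⟨hne, hsC⟩ hfreq
    have hsa : a < s := lt_of_le_of_ne hs.1 (by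
      rintro rfl
      exact hsC (Or.inr rfl))
    have hs' : s ∈ Icc a b := Ico_subset_Icc_self hs
    have hd : HasDerivAt g (deriv g (F s)) (F s) :=
      (differentiableAt_of_deriv_ne_zero hne).hasDerivAt
    have hev : ∀ᶠ s' in 𝓝[≠] s, s' ∈ Icc a b :=
      nhdsWithin_le_nhds (Icc_mem_nhds hsa hs.2)
    have htend : Tendsto F (𝓝[≠] s) (𝓝[≠] (F s)) := by
      refine tendsto_nhdsWithin_iff.2 ⟨hF.continuousAt.tendsto.mono_left nhdsWithin_le_nhds, ?_⟩
      filter_upwards [hev, self_mem_nhdsWithin] with s' h1 h2 h3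
      refine hsC (Or.inl ?_)
      rcases lt_or_gt_of_ne (mem_compl_singleton_iff.1 h2) with h4 | h4
      · exact ⟨s', s, h1, hs', h4, h3, rfl⟩
      · exact ⟨s, s', hs', h1, h4, rfl, h3⟩
    have hev2 := htend.eventually (hd.eventually_ne (c := g (F s)) hne)
    refine hfreq ?_
    filter_upwards [hev, hev2] with s' h1 h2 h3
    exact h2 (by rw [hgF s' h1, hgF s hs', h3]))
  have hvol' : volume ({y | deriv g y ≠ 0} ∩ Ico (F a) (F b)) = 0 := by
    refine measure_mono_null (t := ({y | deriv g y ≠ 0} \ C) ∩ Ico (F a) (F b) ∪ C) ?_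
      (measure_union_null hvol (hCc.measure_zero _))
    rintro y ⟨h1, h2⟩
    by_cases h : y ∈ C
    · exact Or.inr h
    · exact Or.inl ⟨⟨h1, h⟩, h2⟩
  intro s hs
  have ha : a ∈ Icc a b := left_mem_Icc.2 hab
  rw [← hgF s hs, ← hgF a ha]
  exact hg.eq_of_deriv_ae_eq_zero (hmono ha (right_mem_Icc.2 hab) hab) hvol' _
    ⟨hmono ha hs hs.1, hmono hs (right_mem_Icc.2 hab) hs.2⟩

/-- Two measures of the plane, one of which is finite, agree if they agree on quadrants. -/
lemma MeasureTheory.Measure.ext_of_Ici_prod {μ ν : Measure (ℝ × ℝ)} [IsFiniteMeasure μ]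
    (h : ∀ a b, μ (Ici a ×ˢ Ici b) = ν (Ici a ×ˢ Ici b)) : μ = ν := by
  have h1 : ∀ a, ∀ t, MeasurableSet t → μ (Ici a ×ˢ t) = ν (Ici a ×ˢ t) := by
    intro a t ht
    have := Measure.ext_of_Ici ((μ.restrict (Prod.fst ⁻¹' Ici a)).map Prod.snd)
      ((ν.restrict (Prod.fst ⁻¹' Ici a)).map Prod.snd) (fun b => by
        rw [Measure.map_apply measurable_snd measurableSet_Ici,
          Measure.map_apply measurable_snd measurableSet_Ici,
          Measure.restrict_apply (measurable_snd measurableSet_Ici),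
          Measure.restrict_apply (measurable_snd measurableSet_Ici), inter_comm, ← Set.prod_eq, h])
    have := congrArg (fun m : Measure ℝ => m t) this
    beta_reduce at this
    rwa [Measure.map_apply measurable_snd ht, Measure.map_apply measurable_snd ht,
      Measure.restrict_apply (measurable_snd ht), Measure.restrict_apply (measurable_snd ht),
      inter_comm, ← Set.prod_eq] at this
  refine Measure.ext_prod fun {s t} hs ht => ?_
  have := Measure.ext_of_Ici ((μ.restrict (Prod.snd ⁻¹' t)).map Prod.fst)
    ((ν.restrict (Prod.snd ⁻¹' t)).map Prod.fst) (fun a => by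
      rw [Measure.map_apply measurable_fst measurableSet_Ici,
        Measure.map_apply measurable_fst measurableSet_Ici,
        Measure.restrict_apply (measurable_fst measurableSet_Ici),
        Measure.restrict_apply (measurable_fst measurableSet_Ici), ← Set.prod_eq, h1 a t ht])
  have := congrArg (fun m : Measure ℝ => m s) this
  beta_reduce at this
  rwa [Measure.map_apply measurable_fst hs, Measure.map_apply measurable_fst hs,
    Measure.restrict_apply (measurable_fst hs), Measure.restrict_apply (measurable_fst hs),
    ← Set.prod_eq] at this

instance MeasureTheory.Measure.isLocallyFiniteMeasure_add {X : Type*} [TopologicalSpace X]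
    [MeasurableSpace X] (P Q : Measure X) [IsLocallyFiniteMeasure P] [IsLocallyFiniteMeasure Q] :
    IsLocallyFiniteMeasure (P + Q) where
  finiteAtNhds x := by
    obtain ⟨s, hs, hPs⟩ := P.finiteAt_nhds x
    obtain ⟨t, ht, hQt⟩ := Q.finiteAt_nhds x
    refine ⟨s ∩ t, inter_mem hs ht, ?_⟩
    rw [Measure.add_apply]
    exact ENNReal.add_lt_top.2 ⟨(measure_mono inter_subset_left).trans_lt hPs,
      (measure_mono inter_subset_right).trans_lt hQt⟩

namespace PlaneFlow

variable {φ : PlaneFlow} {P Q S : Measure (ℝ × ℝ)} {H : ℝ × ℝ → ℝ}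

/-- The distribution of a potential of `S` in a flow box is a multiple of Lebesgue measure. -/
lemma map_restrict_box_image [IsLocallyFiniteMeasure S] {x : ℝ × ℝ} {F : ℝ → ℝ} {a τ : ℝ}
    (ha : 0 < a) (hτ : 0 < τ) (hF : Continuous F) (hmono : MonotoneOn F (Icc (-a) a))
    (hH : Continuous H) (hHF : ∀ t s, H (φ.box x (t, s)) = F s)
    (hS : ∀ s ∈ Icc (-a) a, S.real (φ.box x '' (Ico 0 τ ×ˢ Ico s a)) = τ * (F a - F s)) :
    (S.restrict (φ.box x '' (Ico 0 τ ×ˢ Ico (-a) a))).map H =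
      ENNReal.ofReal τ • volume.restrict (Ico (F (-a)) (F a)) := by
  have hfin : IsFiniteMeasure (S.restrict (φ.box x '' (Ico 0 τ ×ˢ Ico (-a) a))) :=
    isFiniteMeasure_restrict.2 (measure_box_image_ne_top _ _ _ _ _)
  have hal : -a ∈ Icc (-a) a := left_mem_Icc.2 (by linarith)
  have har : a ∈ Icc (-a) a := right_mem_Icc.2 (by linarith)
  refine Measure.ext_of_Ici _ _ fun y => ?_
  rw [Measure.map_apply hH.measurable measurableSet_Ici,
    Measure.restrict_apply (hH.measurable measurableSet_Ici), Measure.smul_apply,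
    Measure.restrict_apply measurableSet_Ici, smul_eq_mul]
  rcases lt_or_ge (F a) y with hy | hy
  · have h1 : H ⁻¹' Ici y ∩ φ.box x '' (Ico 0 τ ×ˢ Ico (-a) a) = ∅ := by
      rw [eq_empty_iff_forall_notMem]
      rintro _ ⟨h, ⟨t, s⟩, ⟨-, hs⟩, rfl⟩
      rw [mem_preimage, hHF, mem_Ici] at h
      linarith [hmono (Ico_subset_Icc_self hs) har hs.2.le]
    have h2 : Ici y ∩ Ico (F (-a)) (F a) = ∅ := by
      rw [eq_empty_iff_forall_notMem]
      rintro z ⟨h, -, h'⟩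
      rw [mem_Ici] at h
      linarith
    rw [h1, h2]
    simp
  · obtain ⟨s₀, ⟨hs₀, hys₀⟩, hleast⟩ := IsCompact.exists_isLeast (s := Icc (-a) a ∩ F ⁻¹' Ici y)
      (isCompact_Icc.inter_right (isClosed_Ici.preimage hF)) ⟨a, har, hy⟩
    rw [mem_preimage, mem_Ici] at hys₀
    have hmax : F s₀ = max y (F (-a)) := by
      refine le_antisymm ?_ (max_le hys₀ (hmono hal hs₀ hs₀.1))
      rcases le_or_gt y (F (-a)) with h | h
      · exact (hmono hs₀ hal (hleast ⟨hal, h⟩)).trans (le_max_right _ _)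
      · obtain ⟨s₁, hs₁, h₁⟩ := intermediate_value_Icc (by linarith) hF.continuousOn ⟨h.le, hy⟩
        exact ((hmono hs₀ hs₁ (hleast ⟨hs₁, h₁.ge⟩)).trans h₁.le).trans (le_max_left _ _)
    have h1 : H ⁻¹' Ici y ∩ φ.box x '' (Ico 0 τ ×ˢ Ico (-a) a) =
        φ.box x '' (Ico 0 τ ×ˢ Ico s₀ a) := by
      ext z
      constructor
      · rintro ⟨h, ⟨t, s⟩, ⟨ht, hs⟩, rfl⟩
        rw [mem_preimage, hHF] at h
        exact ⟨(t, s), ⟨ht, hleast ⟨Ico_subset_Icc_self hs, h⟩, hs.2⟩, rfl⟩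
      · rintro ⟨⟨t, s⟩, ⟨ht, hs⟩, rfl⟩
        have hs' : s ∈ Ico (-a) a := ⟨hs₀.1.trans hs.1, hs.2⟩
        refine ⟨?_, (t, s), ⟨ht, hs'⟩, rfl⟩
        rw [mem_preimage, hHF]
        exact hys₀.trans (hmono hs₀ (Ico_subset_Icc_self hs') hs.1)
    have h2 : Ici y ∩ Ico (F (-a)) (F a) = Ico (F s₀) (F a) := by
      rw [hmax]
      ext z
      simp only [mem_inter_iff, mem_Ici, mem_Ico, max_le_iff]
      tauto
    rw [h1, h2, Real.volume_Ico, ← ENNReal.ofReal_mul hτ.le, ← hS s₀ hs₀, Measure.real,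
      ENNReal.ofReal_toReal (measure_box_image_ne_top _ _ _ _ _)]

lemma apply_box_of_isPotentialAt (hH : ∀ x, φ.IsPotentialAt P H x) (x : ℝ × ℝ) (t s : ℝ) :
    H (φ.box x (t, s)) = H (φ.box x (0, s)) := by
  rw [← apply_of_isPotentialAt hH t (φ.box x (0, s)), flow_box, add_zero]

/-- Two measures with the same flux across the transversal at `x` agree near `x`. -/
lemma Adapted.exists_restrict_eq [IsLocallyFiniteMeasure P] (hP : φ.Adapted P)
    (hQ : φ.Adapted Q) {x : ℝ × ℝ} {a : ℝ} (ha : 0 < a)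
    (h : ∀ s₁ ∈ Icc (-a) a, ∀ s₂ ∈ Icc s₁ a, ∀ τ ∈ Ioc 0 a,
      P (φ.box x '' (Ico 0 τ ×ˢ Ico s₁ s₂)) = Q (φ.box x '' (Ico 0 τ ×ˢ Ico s₁ s₂))) :
    ∃ V ∈ 𝓝 x, P.restrict V = Q.restrict V := by
  classical
  obtain ⟨e, he, h0, -⟩ := φ.exists_chart x
  obtain ⟨ρ, hρ, hsq⟩ := exists_square_subset (e.open_source.mem_nhds h0)
  set b := min a ρ / 2 with hb
  have hb0 : 0 < b := by positivity
  have hba : 2 * b ≤ a := by linarith [min_le_left a ρ]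
  have hbρ : 2 * b ≤ ρ := by linarith [min_le_right a ρ]
  set K : Set (ℝ × ℝ) := Ico (-b) b ×ˢ Ico (-b) b with hK
  have hKs : K ⊆ e.source := fun p hp =>
    hsq p.1 ⟨by linarith [hp.1.1], by linarith [hp.1.2]⟩ p.2
      ⟨by linarith [hp.2.1], by linarith [hp.2.2]⟩
  have hinv : ∀ p ∈ K, e.symm (φ.box x p) = p := fun p hp => by
    rw [← he, e.left_inv (hKs hp)]
  have hinj : InjOn (φ.box x) K := fun p hp q hq hpq => by
    rw [← hinv p hp, hpq, hinv q hq]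
  have meas : ∀ K' ⊆ K, MeasurableSet K' → MeasurableSet (φ.box x '' K') := fun K' hK' hm =>
    measurableSet_box_image hm (hinj.mono hK')
  have hKm : MeasurableSet K := measurableSet_Ico.prod measurableSet_Ico
  set V := φ.box x '' K with hV
  have hVm : MeasurableSet V := meas K Subset.rfl hKm
  set T : ℝ × ℝ → ℝ × ℝ := V.piecewise e.symm (fun _ => 0) with hT
  have hTm : Measurable T := by
    refine ContinuousOn.measurable_piecewise (e.continuousOn_symm.mono ?_) continuousOn_const hVm
    rintro _ ⟨p, hp, rfl⟩
    rw [← he]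
    exact e.map_source (hKs hp)
  have hTb : ∀ p ∈ K, T (φ.box x p) = p := fun p hp => by
    rw [hT, piecewise_eq_of_mem _ _ _ (mem_image_of_mem _ hp), hinv p hp]
  have hfin : IsFiniteMeasure (P.restrict V) :=
    isFiniteMeasure_restrict.2 (measure_box_image_ne_top _ _ _ _ _)
  have hshift : ∀ {M : Measure (ℝ × ℝ)}, φ.Adapted M → ∀ t ∈ Icc (-b) b, ∀ s ∈ Icc (-b) b,
      M (φ.box x '' (Ico t b ×ˢ Ico s b)) = M (φ.box x '' (Ico 0 (b - t) ×ˢ Ico s b)) := by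
    intro M hM t ht s hs
    have hsub : Ico t b ×ˢ Ico s b ⊆ K :=
      Set.prod_mono (Ico_subset_Ico_left ht.1) (Ico_subset_Ico_left hs.1)
    rw [← (hM.flow t).measure_preimage
      (meas _ hsub (measurableSet_Ico.prod measurableSet_Ico)).nullMeasurableSet]
    congr 1
    ext z
    constructor
    · rintro ⟨⟨t', s'⟩, ⟨ht', hs'⟩, h'⟩
      refine ⟨(-t + t', s'), ⟨⟨by linarith [ht'.1], by linarith [ht'.2]⟩, hs'⟩, ?_⟩
      have h2 := φ.flow_box x (-t) (t', s')
      rw [h', φ.neg_apply] at h2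
      exact h2.symm
    · rintro ⟨⟨t', s'⟩, ⟨ht', hs'⟩, rfl⟩
      exact ⟨(t + t', s'), ⟨⟨by linarith [ht'.1], by linarith [ht'.2]⟩, hs'⟩,
        (φ.flow_box x t (t', s')).symm⟩
  have hmap : (P.restrict V).map T = (Q.restrict V).map T := by
    refine Measure.ext_of_Ici_prod fun c d => ?_
    have hm : MeasurableSet (Ici c ×ˢ Ici d) := measurableSet_Ici.prod measurableSet_Ici
    rw [Measure.map_apply hTm hm, Measure.map_apply hTm hm, Measure.restrict_apply (hTm hm),
      Measure.restrict_apply (hTm hm)]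
    have h1 : T ⁻¹' (Ici c ×ˢ Ici d) ∩ V =
        φ.box x '' (Ico (max c (-b)) b ×ˢ Ico (max d (-b)) b) := by
      ext z
      constructor
      · rintro ⟨h1, p, hp, rfl⟩
        rw [mem_preimage, hTb p hp] at h1
        exact ⟨p, ⟨⟨max_le h1.1 hp.1.1, hp.1.2⟩, ⟨max_le h1.2 hp.2.1, hp.2.2⟩⟩, rfl⟩
      · rintro ⟨p, ⟨⟨h1, h2⟩, h3, h4⟩, rfl⟩
        rw [max_le_iff] at h1 h3
        have hp : p ∈ K := ⟨⟨h1.2, h2⟩, h3.2, h4⟩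
        refine ⟨?_, p, hp, rfl⟩
        rw [mem_preimage, hTb p hp]
        exact ⟨h1.1, h3.1⟩
    rw [h1]
    rcases le_or_gt b c with hc | hc
    · rw [Ico_eq_empty_of_le (hc.trans (le_max_left _ _))]
      simp
    rcases le_or_gt b d with hd | hd
    · rw [Ico_eq_empty_of_le (hd.trans (le_max_left d _))]
      simp
    have hc' : max c (-b) < b := max_lt hc (by linarith)
    have hd' : max d (-b) < b := max_lt hd (by linarith)
    have hc'' := le_max_right c (-b)
    have hd'' := le_max_right d (-b)
    rw [hshift hP _ ⟨hc'', hc'.le⟩ _ ⟨hd'', hd'.le⟩, hshift hQ _ ⟨hc'', hc'.le⟩ _ ⟨hd'', hd'.le⟩]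
    exact h _ ⟨by linarith, by linarith⟩ _ ⟨hd'.le, by linarith⟩ _ ⟨by linarith, by linarith⟩
  have hback : ∀ M : Measure (ℝ × ℝ), ((M.restrict V).map T).map (φ.box x) = M.restrict V := by
    intro M
    rw [Measure.map_map (φ.continuous_box x).measurable hTm]
    refine (Measure.map_congr ?_).trans Measure.map_id
    refine (ae_restrict_mem hVm).mono ?_
    rintro _ ⟨p, hp, rfl⟩
    rw [Function.comp_apply, hTb p hp, id]
  refine ⟨V, box_image_mem_nhds x (prod_mem_nhds (Ico_mem_nhds (by linarith) hb0)
    (Ico_mem_nhds (by linarith) hb0)), ?_⟩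
  rw [← hback P, ← hback Q, hmap]

/-- If almost every point is accumulated, transversally to the flow, by points with the same
difference of potentials, then the two measures agree. -/
lemma Adapted.eq_of_frequently_eq [IsLocallyFiniteMeasure P] [IsLocallyFiniteMeasure Q]
    (hP : φ.Adapted P) (hQ : φ.Adapted Q) {p q : ℝ × ℝ → ℝ}
    (hp : ∀ x, φ.IsPotentialAt P p x) (hq : ∀ x, φ.IsPotentialAt Q q x)
    (h : ∀ᵐ v ∂(P + Q), ∃ᶠ w in 𝓝 v, p w - q w = p v - q v ∧ ∀ t, |t| < 1 → w ≠ φ.Φ t v) :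
    P = Q := by
  suffices hloc : ∀ x, ∃ V ∈ 𝓝 x, P.restrict V = Q.restrict V by
    choose V hV hPQ using hloc
    obtain ⟨s, hs, hun⟩ := TopologicalSpace.countable_cover_nhds hV
    have := hs.to_subtype
    rw [biUnion_eq_iUnion] at hun
    have := (Measure.restrict_iUnion_congr (μ := P) (ν := Q) (s := fun x : s => V x)).2
      fun x => hPQ x
    rwa [hun, Measure.restrict_univ, Measure.restrict_univ] at this
  intro x
  obtain ⟨ε₁, hε₁, hp'⟩ := hp x
  obtain ⟨ε₂, hε₂, hq'⟩ := hq x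
  obtain ⟨e, he, h0, -⟩ := φ.exists_chart x
  obtain ⟨ρ, hρ, hsq⟩ := exists_square_subset (e.open_source.mem_nhds h0)
  set a := min (min ε₁ ε₂) (min ρ 1) / 2 with ha
  have ha0 : 0 < a := by positivity
  have l1 := min_le_left (min ε₁ ε₂) (min ρ 1)
  have l2 := min_le_right (min ε₁ ε₂) (min ρ 1)
  have ha1 : a < ε₁ := by linarith [min_le_left ε₁ ε₂]
  have ha2 : a < ε₂ := by linarith [min_le_right ε₁ ε₂]
  have ha3 : a < ρ := by linarith [min_le_left ρ 1]
  have ha4 : a < 1 := by linarith [min_le_right ρ 1]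
  set p₀ : ℝ → ℝ := fun s => p (φ.box x (0, s)) with hp₀
  set q₀ : ℝ → ℝ := fun s => q (φ.box x (0, s)) with hq₀
  have incP : ∀ s₁ ∈ Icc (-a) a, ∀ s₂ ∈ Icc s₁ a, ∀ τ ∈ Ioc 0 a,
      P.real (φ.box x '' (Ico 0 τ ×ˢ Ico s₁ s₂)) = τ * (p₀ s₂ - p₀ s₁) :=
    fun s₁ h₁ s₂ h₂ τ hτ => (hp' s₁ ⟨by linarith [h₁.1], by linarith [h₁.2]⟩).2 s₂
      ⟨h₂.1, by linarith [h₂.2]⟩ τ ⟨hτ.1, by linarith [hτ.2]⟩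
  have incQ : ∀ s₁ ∈ Icc (-a) a, ∀ s₂ ∈ Icc s₁ a, ∀ τ ∈ Ioc 0 a,
      Q.real (φ.box x '' (Ico 0 τ ×ˢ Ico s₁ s₂)) = τ * (q₀ s₂ - q₀ s₁) :=
    fun s₁ h₁ s₂ h₂ τ hτ => (hq' s₁ ⟨by linarith [h₁.1], by linarith [h₁.2]⟩).2 s₂
      ⟨h₂.1, by linarith [h₂.2]⟩ τ ⟨hτ.1, by linarith [hτ.2]⟩
  have monoP : MonotoneOn p₀ (Icc (-a) a) := fun s₁ h₁ s₂ h₂ h₁₂ => by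
    have := incP s₁ h₁ s₂ ⟨h₁₂, h₂.2⟩ a ⟨ha0, le_rfl⟩
    linarith [nonneg_of_mul_nonneg_right (this ▸ measureReal_nonneg : 0 ≤ a * _) ha0]
  have monoQ : MonotoneOn q₀ (Icc (-a) a) := fun s₁ h₁ s₂ h₂ h₁₂ => by
    have := incQ s₁ h₁ s₂ ⟨h₁₂, h₂.2⟩ a ⟨ha0, le_rfl⟩
    linarith [nonneg_of_mul_nonneg_right (this ▸ measureReal_nonneg : 0 ≤ a * _) ha0]
  have line : Continuous fun s : ℝ => φ.box x (0, s) :=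
    (φ.continuous_box x).comp (by fun_prop)
  have cp := hP.continuous_potential hp
  have cq := hQ.continuous_potential hq
  have cpq : Continuous fun z => p z + q z := cp.add cq
  have key : ∀ s ∈ Icc (-a) a, p₀ s - q₀ s = p₀ (-a) - q₀ (-a) := by
    refine _root_.eq_of_frequently_eq (F := fun s => p₀ s + q₀ s) (G := fun s => p₀ s - q₀ s)
      (by linarith) ((cp.comp line).add (cq.comp line)) ?_ ?_
    · intro s hs s' hs' hss'
      have := monoP hs hs' hss'
      have := monoQ hs hs' hss'
      rw [abs_le]
      constructor <;> linarith
    · intro D hD hDF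
      have hmap := map_restrict_box_image (φ := φ) (S := P + Q) (x := x)
        (F := fun s => p₀ s + q₀ s) (H := fun z => p z + q z) ha0 ha0
        ((cp.comp line).add (cq.comp line)) (monoP.add monoQ) cpq
        (fun t s => by
          rw [apply_box_of_isPotentialAt hp, apply_box_of_isPotentialAt hq])
        (fun s hs => by
          rw [measureReal_add_apply (measure_box_image_ne_top _ _ _ _ _)
            (measure_box_image_ne_top _ _ _ _ _),
            incP s hs a ⟨hs.2, le_rfl⟩ a ⟨ha0, le_rfl⟩, incQ s hs a ⟨hs.2, le_rfl⟩ a ⟨ha0, le_rfl⟩]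
          ring)
      have hmapD := congrArg (fun m : Measure ℝ => m D) hmap
      beta_reduce at hmapD
      rw [Measure.map_apply cpq.measurable hD,
        Measure.restrict_apply (cpq.measurable hD), Measure.smul_apply,
        Measure.restrict_apply hD, smul_eq_mul] at hmapD
      suffices hz : (P + Q) ((fun z => p z + q z) ⁻¹' D ∩
          φ.box x '' (Ico 0 a ×ˢ Ico (-a) a)) = 0 by
        rw [hz] at hmapD
        exact (mul_eq_zero.1 hmapD.symm).resolve_left (ENNReal.ofReal_pos.2 ha0).ne'
      refine measure_mono_null ?_ h
      rintro _ ⟨hzD, ⟨t, s⟩, ⟨ht, hs⟩, rfl⟩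
      simp only [mem_Ico] at ht hs
      rw [mem_preimage, apply_box_of_isPotentialAt hp, apply_box_of_isPotentialAt hq] at hzD
      have hsrc : (t, s) ∈ e.source := hsq t ⟨by linarith, by linarith⟩ s
        ⟨by linarith, by linarith⟩
      have htgt : φ.box x (t, s) ∈ e.target := he _ ▸ e.map_source hsrc
      have hsymm : e.symm (φ.box x (t, s)) = (t, s) := by rw [← he, e.left_inv hsrc]
      have hcont := (e.continuousAt_symm htgt).tendsto
      rw [hsymm] at hcont
      intro hfreq
      refine hDF s hs hzD fun hne => hfreq ?_
      rw [eventually_nhdsWithin_iff] at hne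
      have hne1 := hcont.eventually (continuousAt_snd.eventually hne)
      have hne2 := hcont.eventually (continuousAt_fst.eventually (Metric.ball_mem_nhds t one_pos))
      filter_upwards [hne1, hne2, e.open_target.mem_nhds htgt] with w w1 w2 w3
      rintro ⟨w4, w5⟩
      have hw : φ.box x ((e.symm w).1, (e.symm w).2) = w := by
        rw [← he]; exact e.right_inv w3
      by_cases hws : (e.symm w).2 = s
      · refine w5 ((e.symm w).1 - t) ?_ ?_
        · rw [← Real.dist_eq]; exact w2
        · rw [flow_box]
          simp only [sub_add_cancel]
          rw [← hws]
          exact hw.symm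
      · refine w1 hws ?_
        rw [← hw, apply_box_of_isPotentialAt hp, apply_box_of_isPotentialAt hq,
          apply_box_of_isPotentialAt hp x t, apply_box_of_isPotentialAt hq x t] at w4
        exact w4
  refine hP.exists_restrict_eq hQ ha0 fun s₁ h₁ s₂ h₂ τ hτ => ?_
  rw [← measureReal_eq_measureReal_iff (measure_box_image_ne_top _ _ _ _ _)
    (measure_box_image_ne_top _ _ _ _ _), incP s₁ h₁ s₂ h₂ τ hτ, incQ s₁ h₁ s₂ h₂ τ hτ]
  congr 1
  linarith [key s₁ h₁, key s₂ ⟨h₁.1.trans h₂.1, h₂.2⟩]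

end PlaneFlow

lemma latticeVec_zero : latticeVec 0 = 0 := by
  simp [latticeVec, ← Prod.mk_zero_zero]

lemma latticeVec_injective : Function.Injective latticeVec := by
  intro k l h
  simp only [latticeVec, Prod.mk.injEq, Int.cast_inj] at h
  exact Prod.ext h.1 h.2

lemma indicator_one_congr {X Y : Type*} {A : Set X} {B : Set Y} {a : X} {b : Y}
    (h : a ∈ A ↔ b ∈ B) : A.indicator (1 : X → ENNReal) a = B.indicator (1 : Y → ENNReal) b := by
  by_cases ha : a ∈ A
  · rw [indicator_of_mem ha, indicator_of_mem (h.1 ha), Pi.one_apply, Pi.one_apply]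
  · rw [indicator_of_notMem ha, indicator_of_notMem fun hb => ha (h.2 hb)]

lemma continuous_projT2 : Continuous projT2 :=
  ((AddCircle.continuous_mk' 1).comp continuous_fst).prodMk
    ((AddCircle.continuous_mk' 1).comp continuous_snd)

lemma isOpenMap_projT2 : IsOpenMap projT2 :=
  QuotientAddGroup.isOpenMap_coe.prodMap QuotientAddGroup.isOpenMap_coe

lemma surjective_projT2 : Function.Surjective projT2 :=
  (QuotientAddGroup.mk_surjective).prodMap (QuotientAddGroup.mk_surjective)

lemma projT2_eq_iff {v w : ℝ × ℝ} : projT2 v = projT2 w ↔ ∃ k, w = v + latticeVec k := by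
  have h : ∀ a b : ℝ, ((a : AddCircle (1 : ℝ)) = b) ↔ ∃ n : ℤ, b = a + n := by
    intro a b
    rw [eq_comm, ← sub_eq_zero, ← AddCircle.coe_sub, AddCircle.coe_eq_zero_iff]
    refine exists_congr fun n => ?_
    rw [zsmul_one]
    constructor <;> intro h <;> linarith
  simp only [projT2, Prod.mk.injEq, h]
  constructor
  · rintro ⟨⟨m, hm⟩, n, hn⟩
    exact ⟨(m, n), Prod.ext hm hn⟩
  · rintro ⟨k, rfl⟩
    exact ⟨⟨k.1, rfl⟩, k.2, rfl⟩

lemma projT2_add (v : ℝ × ℝ) (k : ℤ × ℤ) : projT2 (v + latticeVec k) = projT2 v :=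
  (projT2_eq_iff.2 ⟨k, rfl⟩).symm

/-- Two continuous maps lifting the same map to the torus and agreeing at a point are equal. -/
lemma eq_of_projT2_eq {X : Type*} [TopologicalSpace X] [PreconnectedSpace X] {f g : X → ℝ × ℝ}
    (hf : Continuous f) (hg : Continuous g) (hfg : ∀ x, projT2 (f x) = projT2 (g x)) {x₀ : X}
    (h0 : f x₀ = g x₀) : f = g := by
  choose k hk using fun x => projT2_eq_iff.1 (hfg x)
  have hk' : ∀ x, latticeVec (k x) = g x - f x := fun x => by rw [hk x]; abel
  have hc : Continuous fun x => latticeVec (k x) := by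
    simp only [hk']
    exact hg.sub hf
  have h1 : Continuous fun x => (k x).1 :=
    Int.isClosedEmbedding_coe_real.isInducing.continuous_iff.2 (continuous_fst.comp hc)
  have h2 : Continuous fun x => (k x).2 :=
    Int.isClosedEmbedding_coe_real.isInducing.continuous_iff.2 (continuous_snd.comp hc)
  have hk0 : k x₀ = 0 := latticeVec_injective (by rw [hk', h0, sub_self, latticeVec_zero])
  funext x
  have e : k x = 0 := by
    rw [← hk0]
    exact Prod.ext (PreconnectedSpace.constant ‹_› h1) (PreconnectedSpace.constant ‹_› h2)
  rw [hk x, e, latticeVec_zero, add_zero]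

namespace C1FlowT2

/-- The flow of the plane lifting a flow of the torus. -/
lemma exists_planeFlow (h : C1FlowT2) (hcrit : h.NoCriticalPoints) (hper : h.NoPeriodicOrbits) :
    ∃ φ : PlaneFlow, ∀ t v, projT2 (φ.Φ t v) = h.flow t (projT2 v) := by
  have hlift : Continuous (Function.uncurry h.lift) := h.lift_contDiff.continuous
  have hlift0 : Continuous (h.lift 0) := hlift.comp (Continuous.prodMk_right 0)
  obtain ⟨k₀, hk₀⟩ : ∃ k, h.lift 0 0 = 0 + latticeVec k :=
    projT2_eq_iff.1 (by rw [h.lift_proj, h.flow_zero])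
  set Φ : ℝ → ℝ × ℝ → ℝ × ℝ := fun t v => h.lift t v - latticeVec k₀ with hΦ
  have hcont : Continuous (Function.uncurry Φ) := hlift.sub continuous_const
  have hproj : ∀ t v, projT2 (Φ t v) = h.flow t (projT2 v) := fun t v => by
    rw [← h.lift_proj, ← projT2_add (Φ t v) k₀, hΦ, sub_add_cancel]
  have hzero : ∀ v, Φ 0 v = v := by
    have : Φ 0 = id := eq_of_projT2_eq (x₀ := 0) (hlift0.sub continuous_const) continuous_id
      (fun v => by rw [hproj, h.flow_zero, id]) (by simp [hΦ, hk₀])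
    exact fun v => congrFun this v
  refine ⟨⟨Φ, h.lift_contDiff.sub contDiff_const, hzero, fun t s v => ?_, fun t v k => ?_,
    fun v => ?_, fun v T k hT hTv => ?_⟩, hproj⟩
  · have : (fun z : ℝ × ℝ => Φ (z.1 + z.2) v) = fun z => Φ z.1 (Φ z.2 v) := by
      refine eq_of_projT2_eq (x₀ := 0) ?_ ?_ (fun z => ?_) ?_
      · exact hcont.comp (by fun_prop : Continuous fun z : ℝ × ℝ => (z.1 + z.2, v))
      · exact hcont.comp (continuous_fst.prodMk
          (hcont.comp (by fun_prop : Continuous fun z : ℝ × ℝ => (z.2, v))))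
      · rw [hproj, hproj, hproj, h.flow_add]
      · simp [hzero]
    exact congrFun this (t, s)
  · have : (fun t => Φ t (v + latticeVec k)) = fun t => Φ t v + latticeVec k := by
      refine eq_of_projT2_eq (x₀ := 0) ?_ ?_ (fun t => ?_) ?_
      · exact hcont.comp (Continuous.prodMk_left _)
      · exact (hcont.comp (Continuous.prodMk_left v)).add continuous_const
      · rw [projT2_add, hproj, hproj, projT2_add]
      · rw [hzero, hzero]
    exact congrFun this t
  · have := hcrit v
    simp only [hΦ]
    rwa [deriv_sub_const]
  · refine hper (projT2 v) T hT ?_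
    rw [← hproj, hTv, projT2_add]

end C1FlowT2

/-- A measurable section of the projection to the torus. -/
def sectionT2 (x : T2) : ℝ × ℝ :=
  (AddCircle.measurableEquivIco 1 0 x.1, AddCircle.measurableEquivIco 1 0 x.2)

lemma measurable_sectionT2 : Measurable sectionT2 :=
  ((measurable_subtype_coe.comp (AddCircle.measurableEquivIco 1 0).measurable).comp
    measurable_fst).prodMk ((measurable_subtype_coe.comp
      (AddCircle.measurableEquivIco 1 0).measurable).comp measurable_snd)

lemma projT2_sectionT2 (x : T2) : projT2 (sectionT2 x) = x :=
  Prod.ext ((AddCircle.equivIco 1 0).symm_apply_apply x.1)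
    ((AddCircle.equivIco 1 0).symm_apply_apply x.2)

/-- The number of points of `A` in a fibre of the projection to the torus. -/
def fibreCount (A : Set (ℝ × ℝ)) (x : T2) : ENNReal :=
  ∑' k : ℤ × ℤ, A.indicator 1 (sectionT2 x + latticeVec k)

lemma tsum_indicator_eq_fibreCount (A : Set (ℝ × ℝ)) (w : ℝ × ℝ) :
    ∑' k : ℤ × ℤ, A.indicator (1 : ℝ × ℝ → ENNReal) (w + latticeVec k) =
      fibreCount A (projT2 w) := by
  obtain ⟨l, hl⟩ := projT2_eq_iff.1 (projT2_sectionT2 (projT2 w))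
  rw [fibreCount, ← (Equiv.addLeft l).tsum_eq fun k =>
    A.indicator (1 : ℝ × ℝ → ENNReal) (sectionT2 (projT2 w) + latticeVec k)]
  refine tsum_congr fun k => ?_
  nth_rw 1 [hl]
  rw [Equiv.coe_addLeft, latticeVec_add, ← add_assoc]

lemma measurable_fibreCount {A : Set (ℝ × ℝ)} (hA : MeasurableSet A) :
    Measurable (fibreCount A) :=
  Measurable.tsum fun _ =>
    (measurable_one.indicator hA).comp (measurable_sectionT2.add_const _)

/-- The measure of the plane lifting a measure of the torus. -/
def liftMeasure (μ : Measure T2) : Measure (ℝ × ℝ) :=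
  Measure.sum fun k : ℤ × ℤ => μ.map fun x => sectionT2 x + latticeVec k

lemma liftMeasure_apply (μ : Measure T2) {A : Set (ℝ × ℝ)} (hA : MeasurableSet A) :
    liftMeasure μ A = ∫⁻ x, fibreCount A x ∂μ := by
  have hm : ∀ k : ℤ × ℤ, Measurable fun x => sectionT2 x + latticeVec k := fun k =>
    measurable_sectionT2.add_const _
  simp only [fibreCount]
  rw [lintegral_tsum (f := fun k x => A.indicator 1 (sectionT2 x + latticeVec k)) fun k =>
    ((measurable_one.indicator hA).comp (hm k)).aemeasurable, liftMeasure, Measure.sum_apply _ hA]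
  refine tsum_congr fun k => ?_
  rw [← lintegral_indicator_one hA, lintegral_map (measurable_one.indicator hA) (hm k)]

lemma fibreCount_preimage_projT2 (N : Set T2) (x : T2) (hx : x ∉ N) :
    fibreCount (projT2 ⁻¹' N) x = 0 := by
  refine ENNReal.tsum_eq_zero.2 fun k => indicator_of_notMem ?_ _
  rwa [mem_preimage, projT2_add, projT2_sectionT2]

lemma ae_liftMeasure {μ : Measure T2} {p : T2 → Prop} (h : ∀ᵐ x ∂μ, p x) :
    ∀ᵐ v ∂liftMeasure μ, p (projT2 v) := by
  have hN : MeasurableSet (toMeasurable μ {x | ¬ p x}) := measurableSet_toMeasurable _ _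
  have h0 : liftMeasure μ (projT2 ⁻¹' toMeasurable μ {x | ¬ p x}) = 0 := by
    rw [liftMeasure_apply μ (continuous_projT2.measurable hN), lintegral_eq_zero_iff
      (measurable_fibreCount (continuous_projT2.measurable hN))]
    have : μ (toMeasurable μ {x | ¬ p x}) = 0 := by rw [measure_toMeasurable]; exact h
    filter_upwards [measure_eq_zero_iff_ae_notMem.1 this] with x hx
    exact fibreCount_preimage_projT2 _ x hx
  exact measure_mono_null (fun v hv => subset_toMeasurable μ {x | ¬ p x} hv) h0

/-- The lifted measure restricted to the fundamental domain given by the section. -/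
lemma liftMeasure_inter_fundamental (μ : Measure T2) {N : Set T2} (hN : MeasurableSet N) :
    liftMeasure μ (projT2 ⁻¹' N ∩ {v | sectionT2 (projT2 v) = v}) = μ N := by
  have hD : MeasurableSet {v : ℝ × ℝ | sectionT2 (projT2 v) = v} :=
    measurableSet_eq_fun (measurable_sectionT2.comp continuous_projT2.measurable) measurable_id
  rw [liftMeasure_apply μ ((continuous_projT2.measurable hN).inter hD),
    ← lintegral_indicator_one hN]
  refine lintegral_congr fun x => ?_
  rw [fibreCount, tsum_eq_single 0]
  · rw [latticeVec_zero, add_zero]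
    refine indicator_one_congr ?_
    rw [mem_inter_iff, mem_preimage, mem_ofPred_eq, projT2_sectionT2, and_iff_left rfl]
  · intro k hk
    refine indicator_of_notMem (fun hmem => hk ?_) _
    have := hmem.2
    rw [mem_ofPred_eq, projT2_add, projT2_sectionT2, left_eq_add] at this
    exact latticeVec_injective (this.trans latticeVec_zero.symm)

lemma isLocallyFiniteMeasure_liftMeasure (μ : Measure T2) [IsFiniteMeasure μ] :
    IsLocallyFiniteMeasure (liftMeasure μ) where
  finiteAtNhds v := by
    refine ⟨Metric.ball v (1 / 2), Metric.ball_mem_nhds _ (by norm_num), ?_⟩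
    rw [liftMeasure_apply μ measurableSet_ball]
    refine lt_of_le_of_lt (lintegral_mono (g := fun _ => 1) fun x => ?_)
      (by simp [measure_lt_top])
    by_cases hx : ∃ k, sectionT2 x + latticeVec k ∈ Metric.ball v (1 / 2)
    · obtain ⟨k, hk⟩ := hx
      rw [fibreCount, tsum_eq_single k]
      · exact indicator_le_self' (fun _ _ => zero_le) _
      · intro l hl
        refine indicator_of_notMem (fun hmem => hl ?_) _
        have h1 : dist (sectionT2 x + latticeVec l) (sectionT2 x + latticeVec k) < 1 := by
          have := dist_triangle_right (sectionT2 x + latticeVec l) (sectionT2 x + latticeVec k) v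
          rw [Metric.mem_ball] at hk hmem
          linarith
        rw [dist_add_left, Prod.dist_eq, max_lt_iff] at h1
        simp only [latticeVec, Int.dist_cast_real] at h1
        have h2 : ∀ m n : ℤ, dist m n < 1 → m = n := by
          intro m n h
          rw [Int.dist_eq, ← Int.cast_sub, ← Int.cast_abs] at h
          have : |m - n| < 1 := by exact_mod_cast h
          rwa [Int.abs_lt_one_iff, sub_eq_zero] at this
        exact Prod.ext (h2 _ _ h1.1) (h2 _ _ h1.2)
    · push Not at hx
      rw [fibreCount, ENNReal.tsum_eq_zero.2 fun k => indicator_of_notMem (hx k) _]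
      exact zero_le

lemma iterate_flow (h : C1FlowT2) (t : ℝ) (n : ℕ) (x : T2) :
    (h.flow t)^[n] x = h.flow (n * t) x := by
  induction n with
  | zero => simp [h.flow_zero]
  | succ n ih =>
    rw [Function.iterate_succ_apply', ih, ← h.flow_add]
    congr 1
    push_cast
    ring

lemma adapted_liftMeasure {h : C1FlowT2} {φ : PlaneFlow} (hper : h.NoPeriodicOrbits)
    (hφ : ∀ t v, projT2 (φ.Φ t v) = h.flow t (projT2 v)) {μ : Measure T2} [IsFiniteMeasure μ]
    (hμ : ∀ t, MeasurePreserving (h.flow t) μ μ) : φ.Adapted (liftMeasure μ) where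
  flow t := by
    refine ⟨(φ.continuous_flow t).measurable, Measure.ext fun A hA => ?_⟩
    have hm := (φ.continuous_flow t).measurable hA
    rw [Measure.map_apply (φ.continuous_flow t).measurable hA, liftMeasure_apply μ hm,
      liftMeasure_apply μ hA, ← (hμ t).lintegral_comp (measurable_fibreCount hA)]
    refine lintegral_congr fun x => ?_
    rw [← projT2_sectionT2 x, ← hφ, ← tsum_indicator_eq_fibreCount, ← tsum_indicator_eq_fibreCount]
    refine tsum_congr fun k => ?_
    refine indicator_one_congr ?_
    rw [mem_preimage, φ.equivariant]
  translate k := by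
    have hm : Measurable fun v : ℝ × ℝ => v + latticeVec k := by fun_prop
    refine ⟨hm, Measure.ext fun A hA => ?_⟩
    rw [Measure.map_apply hm hA, liftMeasure_apply μ (hm hA), liftMeasure_apply μ hA]
    refine lintegral_congr fun x => ?_
    rw [fibreCount, fibreCount, ← (Equiv.addRight k).tsum_eq fun l =>
      A.indicator (1 : ℝ × ℝ → ENNReal) (sectionT2 x + latticeVec l)]
    refine tsum_congr fun l => ?_
    refine indicator_one_congr ?_
    rw [mem_preimage, Equiv.coe_addRight, latticeVec_add, add_assoc]
  orbit p := by
    have hcont : Continuous fun t => φ.Φ t p :=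
      φ.continuous_uncurry.comp (Continuous.prodMk_left p)
    set K : Set T2 := (fun t => projT2 (φ.Φ t p)) '' Icc 0 1 with hK
    have hKc : IsCompact K := isCompact_Icc.image (continuous_projT2.comp hcont)
    have hK0 : μ K = 0 := by
      by_contra hne
      obtain ⟨_, ⟨t, ht, rfl⟩, m, hm, t', ht', hx⟩ := ((hμ 2).conservative).exists_mem_iterate_mem
        hKc.measurableSet.nullMeasurableSet hne
      simp only [iterate_flow, hφ] at hx
      rw [← h.flow_add] at hx
      have hm1 : (1 : ℝ) ≤ m := by exact_mod_cast Nat.one_le_iff_ne_zero.2 hm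
      refine hper (h.flow t' (projT2 p)) (m * 2 + t - t') ?_ ?_
      · linarith [ht.1, ht'.2]
      · rw [← h.flow_add, sub_add_cancel, hx]
    refine measure_mono_null ?_ (ae_liftMeasure (measure_eq_zero_iff_ae_notMem.1 hK0))
    rintro _ ⟨t, ht, rfl⟩
    simp only [mem_compl_iff, mem_ofPred_eq, not_not]
    exact ⟨t, Ico_subset_Icc_self ht, rfl⟩

namespace PlaneFlow

variable {φ : PlaneFlow} {M N : Measure (ℝ × ℝ)}

lemma Adapted.combine (hM : φ.Adapted M) (hN : φ.Adapted N) (a b : NNReal) :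
    φ.Adapted (a • M + b • N) where
  flow t := by
    refine ⟨(hM.flow t).measurable, ?_⟩
    rw [Measure.map_add _ _ (hM.flow t).measurable, Measure.map_smul, Measure.map_smul,
      (hM.flow t).map_eq, (hN.flow t).map_eq]
  translate k := by
    refine ⟨(hM.translate k).measurable, ?_⟩
    rw [Measure.map_add _ _ (hM.translate k).measurable, Measure.map_smul, Measure.map_smul,
      (hM.translate k).map_eq, (hN.translate k).map_eq]
  orbit p := by
    rw [Measure.add_apply, Measure.coe_nnreal_smul_apply, Measure.coe_nnreal_smul_apply,
      hM.orbit, hN.orbit, mul_zero, mul_zero, add_zero]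

variable (φ) in
/-- The point `w` is an integer translate of a point of the positive orbit of `v` at a positive
integer time. -/
def IsReturn (v w : ℝ × ℝ) : Prop :=
  ∃ n : ℕ, n ≠ 0 ∧ ∃ k, w = φ.Φ n v + latticeVec k

lemma IsReturn.ne_apply {v w : ℝ × ℝ} (h : φ.IsReturn v w) {t : ℝ} (ht : |t| < 1) :
    w ≠ φ.Φ t v := by
  obtain ⟨n, hn, k, rfl⟩ := h
  intro heq
  have hn1 : (1 : ℝ) ≤ n := by exact_mod_cast Nat.one_le_iff_ne_zero.2 hn
  refine φ.nonperiodic v (n - t) (-k) (by linarith [(abs_lt.1 ht).2]) ?_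
  have h2 : φ.Φ n v = φ.Φ t (v + latticeVec (-k)) := by
    rw [φ.equivariant, ← heq, add_assoc, ← latticeVec_add, add_neg_cancel, latticeVec_zero,
      add_zero]
  rw [sub_eq_neg_add, φ.add, h2, φ.neg_apply]

/-- Two periodic-increment functions have a combination which is preserved along close enough
returns. -/
lemma exists_combination_eq {f g : ℝ × ℝ → ℝ} (hf : Continuous f) (hg : Continuous g)
    (hfΦ : ∀ t v, f (φ.Φ t v) = f v) (hgΦ : ∀ t v, g (φ.Φ t v) = g v) {α β γ δ : ℝ}
    (hfk : ∀ v k, f (v + latticeVec k) = f v + (k.1 * α + k.2 * β))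
    (hgk : ∀ v k, g (v + latticeVec k) = g v + (k.1 * γ + k.2 * δ)) :
    ∃ a b : ℝ, (a, b) ≠ 0 ∧ ∀ v, ∀ᶠ w in 𝓝 v, φ.IsReturn v w →
      a * f w + b * g w = a * f v + b * g v := by
  have hret : ∀ v w, φ.IsReturn v w → ∃ k : ℤ × ℤ, f w = f v + (k.1 * α + k.2 * β) ∧
      g w = g v + (k.1 * γ + k.2 * δ) := by
    rintro v _ ⟨n, -, k, rfl⟩
    exact ⟨k, by rw [hfk, hfΦ], by rw [hgk, hgΦ]⟩
  by_cases hdet : α * δ - β * γ = 0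
  · have key : ∀ a b : ℝ, a * α + b * γ = 0 → a * β + b * δ = 0 → ∀ v w, φ.IsReturn v w →
        a * f w + b * g w = a * f v + b * g v := by
      intro a b h1 h2 v w hw
      obtain ⟨k, hk1, hk2⟩ := hret v w hw
      rw [hk1, hk2]
      linear_combination (k.1 : ℝ) * h1 + (k.2 : ℝ) * h2
    by_cases h1 : (γ, -α) = 0
    · by_cases h2 : (δ, -β) = 0
      · simp only [Prod.mk_eq_zero, neg_eq_zero] at h1 h2
        exact ⟨1, 0, by simp, fun v => .of_forall
          (key 1 0 (by rw [h1.1, h1.2]; ring) (by rw [h2.1, h2.2]; ring) v)⟩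
      · exact ⟨δ, -β, h2, fun v => .of_forall
          (key δ (-β) (by linear_combination hdet) (by ring) v)⟩
    · exact ⟨γ, -α, h1, fun v => .of_forall
        (key γ (-α) (by ring) (by linear_combination -hdet) v)⟩
  · refine ⟨1, 0, by simp, fun v => ?_⟩
    set C := |α| + |β| + |γ| + |δ| + 1 with hC
    have hCpos : 0 < C := by positivity
    have hε : 0 < |α * δ - β * γ| / C := div_pos (abs_pos.2 hdet) hCpos
    filter_upwards [Metric.tendsto_nhds.1 (hf.tendsto v) _ hε,
      Metric.tendsto_nhds.1 (hg.tendsto v) _ hε] with w hfw hgw hw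
    obtain ⟨k, hk1, hk2⟩ := hret v w hw
    rw [Real.dist_eq, hk1, add_sub_cancel_left, lt_div_iff₀ hCpos] at hfw
    rw [Real.dist_eq, hk2, add_sub_cancel_left, lt_div_iff₀ hCpos] at hgw
    have hsmall : ∀ (m : ℤ) (p q : ℝ), |p| + |q| ≤ C →
        (m : ℝ) * (α * δ - β * γ) = p * (k.1 * α + k.2 * β) + q * (k.1 * γ + k.2 * δ) →
        m = 0 := by
      intro m p q hpq hm
      by_contra hne
      have h1 : (1 : ℝ) ≤ |(m : ℝ)| := by
        rw [← Int.cast_abs]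
        exact_mod_cast Int.one_le_abs hne
      have h2 : |α * δ - β * γ| ≤ |p| * |k.1 * α + k.2 * β| + |q| * |k.1 * γ + k.2 * δ| := by
        rw [← abs_mul, ← abs_mul]
        refine le_trans ?_ (abs_add_le _ _)
        rw [← hm, abs_mul]
        exact le_mul_of_one_le_left (abs_nonneg _) h1
      set x := |k.1 * α + k.2 * β|
      set y := |k.1 * γ + k.2 * δ|
      have hx : x ≤ max x y := le_max_left _ _
      have hy : y ≤ max x y := le_max_right _ _
      have h3 : max x y * C < |α * δ - β * γ| := by
        rcases max_choice x y with h | h <;> rw [h] <;> assumption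
      have h4 : |p| * x + |q| * y ≤ max x y * C := by
        calc |p| * x + |q| * y ≤ |p| * max x y + |q| * max x y := by gcongr
          _ = max x y * (|p| + |q|) := by ring
          _ ≤ max x y * C := by gcongr
      linarith
    have e1 : k.1 = 0 := hsmall k.1 δ (-β)
      (by rw [abs_neg, hC]; linarith [abs_nonneg α, abs_nonneg γ]) (by ring)
    have e2 : k.2 = 0 := hsmall k.2 (-γ) α
      (by rw [abs_neg, hC]; linarith [abs_nonneg β, abs_nonneg δ]) (by ring)
    rw [hk1, hk2, e1, e2]
    simp

/-- Two adapted measures whose almost all points have close returns are linearly dependent. -/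
lemma Adapted.exists_combination_eq [IsLocallyFiniteMeasure M] [IsLocallyFiniteMeasure N]
    (hM : φ.Adapted M) (hN : φ.Adapted N)
    (hMr : ∀ᵐ v ∂M, ∃ᶠ w in 𝓝 v, φ.IsReturn v w) (hNr : ∀ᵐ v ∂N, ∃ᶠ w in 𝓝 v, φ.IsReturn v w) :
    ∃ a b : ℝ, (a, b) ≠ 0 ∧
      a.toNNReal • M + b.toNNReal • N = (-a).toNNReal • M + (-b).toNNReal • N := by
  obtain ⟨f, hf⟩ := hM.exists_potential
  obtain ⟨g, hg⟩ := hN.exists_potential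
  obtain ⟨α, β, hfk⟩ := exists_periods hM hf
  obtain ⟨γ, δ, hgk⟩ := exists_periods hN hg
  obtain ⟨a, b, hab, h⟩ := φ.exists_combination_eq (hM.continuous_potential hf)
    (hN.continuous_potential hg) (apply_of_isPotentialAt hf) (apply_of_isPotentialAt hg) hfk hgk
  refine ⟨a, b, hab, (hM.combine hN _ _).eq_of_frequently_eq (hM.combine hN _ _)
    (fun x => (hf x).combine (hg x) _ _) (fun x => (hf x).combine (hg x) _ _) ?_⟩
  have hdiff : ∀ z, ((a.toNNReal : ℝ) * f z + b.toNNReal * g z) -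
      ((-a).toNNReal * f z + (-b).toNNReal * g z) = a * f z + b * g z := by
    intro z
    simp only [Real.coe_toNNReal']
    linear_combination f z * max_zero_sub_max_neg_zero_eq_self a +
      g z * max_zero_sub_max_neg_zero_eq_self b
  have hr : ∀ v, (∃ᶠ w in 𝓝 v, φ.IsReturn v w) → ∃ᶠ w in 𝓝 v,
      ((a.toNNReal : ℝ) * f w + b.toNNReal * g w) -
        ((-a).toNNReal * f w + (-b).toNNReal * g w) =
      ((a.toNNReal : ℝ) * f v + b.toNNReal * g v) -
        ((-a).toNNReal * f v + (-b).toNNReal * g v) ∧ ∀ t, |t| < 1 → w ≠ φ.Φ t v := by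
    intro v hv
    refine (hv.and_eventually (h v)).mono fun w hw => ?_
    rw [hdiff, hdiff]
    exact ⟨hw.2 hw.1, fun t => hw.1.ne_apply⟩
  simp only [ae_add_measure_iff]
  have hMr' := hMr.mono hr
  have hNr' := hNr.mono hr
  exact ⟨⟨Measure.ae_smul_measure hMr' _, Measure.ae_smul_measure hNr' _⟩,
    Measure.ae_smul_measure hMr' _, Measure.ae_smul_measure hNr' _⟩

end PlaneFlow

lemma ae_frequently_isReturn {h : C1FlowT2} {φ : PlaneFlow}
    (hφ : ∀ t v, projT2 (φ.Φ t v) = h.flow t (projT2 v)) {μ : Measure T2} [IsFiniteMeasure μ]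
    (hμ : ∀ t, MeasurePreserving (h.flow t) μ μ) :
    ∀ᵐ v ∂liftMeasure μ, ∃ᶠ w in 𝓝 v, φ.IsReturn v w := by
  filter_upwards [ae_liftMeasure (hμ 1).conservative.ae_frequently_mem_of_mem_nhds] with v hv
  refine frequently_iff.2 fun {U} hU => ?_
  obtain ⟨n, ⟨u, hu, hun⟩, hn⟩ :=
    ((hv _ (isOpenMap_projT2.image_mem_nhds hU)).and_eventually (eventually_ne_atTop 0)).exists
  rw [iterate_flow, mul_one, ← hφ, eq_comm, projT2_eq_iff] at hun
  exact ⟨u, hu, n, hn, hun⟩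

/-- Uniqueness of the invariant probability measure. -/
lemma eq_of_invariant {h : C1FlowT2} (hcrit : h.NoCriticalPoints) (hper : h.NoPeriodicOrbits)
    {μ ν : Measure T2} [IsProbabilityMeasure μ] [IsProbabilityMeasure ν]
    (hμ : ∀ t, MeasurePreserving (h.flow t) μ μ) (hν : ∀ t, MeasurePreserving (h.flow t) ν ν) :
    μ = ν := by
  obtain ⟨φ, hφ⟩ := h.exists_planeFlow hcrit hper
  have := isLocallyFiniteMeasure_liftMeasure μ
  have := isLocallyFiniteMeasure_liftMeasure ν
  obtain ⟨a, b, hab, heq⟩ := (adapted_liftMeasure hper hφ hμ).exists_combination_eq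
    (adapted_liftMeasure hper hφ hν) (ae_frequently_isReturn hφ hμ) (ae_frequently_isReturn hφ hν)
  have key : ∀ N, MeasurableSet N → a * μ.real N + b * ν.real N = 0 := by
    intro N hN
    have h1 := congrArg
      (fun P : Measure (ℝ × ℝ) => (P (projT2 ⁻¹' N ∩ {v | sectionT2 (projT2 v) = v})).toReal) heq
    simp only [Measure.add_apply, Measure.coe_nnreal_smul_apply,
      liftMeasure_inter_fundamental _ hN] at h1
    rw [ENNReal.toReal_add (by finiteness) (by finiteness),
      ENNReal.toReal_add (by finiteness) (by finiteness)] at h1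
    simp only [ENNReal.toReal_mul, ENNReal.coe_toReal, Real.coe_toNNReal', ← measureReal_def] at h1
    linear_combination h1 - μ.real N * max_zero_sub_max_neg_zero_eq_self a -
      ν.real N * max_zero_sub_max_neg_zero_eq_self b
  have hsum : a + b = 0 := by simpa using key univ .univ
  have ha : a ≠ 0 := by
    rintro rfl
    exact hab (by rw [zero_add] at hsum; rw [hsum]; rfl)
  refine Measure.ext fun N hN => ?_
  rw [← measureReal_eq_measureReal_iff]
  refine mul_left_cancel₀ ha ?_
  linear_combination key N hN - ν.real N * hsum

namespace C1FlowT2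

variable (h : C1FlowT2)

lemma continuous_flow (t : ℝ) : Continuous (h.flow t) := by
  rw [(isOpenMap_projT2.isQuotientMap continuous_projT2 surjective_projT2).continuous_iff]
  have : h.flow t ∘ projT2 = fun v => projT2 (h.lift t v) := funext fun v => (h.lift_proj t v).symm
  rw [this]
  exact continuous_projT2.comp (h.lift_contDiff.continuous.comp (Continuous.prodMk_right t))

lemma continuous_orbit (x : T2) : Continuous fun t => h.flow t x := by
  obtain ⟨v, rfl⟩ := surjective_projT2 x
  simp only [← h.lift_proj]
  exact continuous_projT2.comp (h.lift_contDiff.continuous.comp (Continuous.prodMk_left v))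

/-- The average of Dirac masses along the orbit of `x` during time `n + 1`. -/
def timeAverage (x : T2) (n : ℕ) : Measure T2 :=
  ((n + 1 : NNReal)⁻¹ • volume.restrict (Ioc (0 : ℝ) (n + 1))).map fun t => h.flow t x

instance (x : T2) (n : ℕ) : IsProbabilityMeasure (h.timeAverage x n) := by
  have : IsProbabilityMeasure ((n + 1 : NNReal)⁻¹ • volume.restrict (Ioc (0 : ℝ) (n + 1))) := by
    refine ⟨?_⟩
    rw [Measure.coe_nnreal_smul_apply, Measure.restrict_apply_univ, Real.volume_Ioc, sub_zero,
      ENNReal.coe_inv (by positivity), ← ENNReal.inv_mul_cancel (a := ((n + 1 : NNReal) : ENNReal))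
        (by simp) ENNReal.coe_ne_top]
    congr 1
    rw [← ENNReal.ofReal_coe_nnreal]
    simp
  exact Measure.isProbabilityMeasure_map (h.continuous_orbit x).measurable.aemeasurable

lemma integral_timeAverage (x : T2) (n : ℕ) {f : T2 → ℝ} (hf : Continuous f) :
    ∫ y, f y ∂h.timeAverage x n = (n + 1 : ℝ)⁻¹ * ∫ s in (0 : ℝ)..(n + 1), f (h.flow s x) := by
  rw [timeAverage, integral_map (h.continuous_orbit x).measurable.aemeasurable
    hf.aestronglyMeasurable, integral_smul_nnreal_measure,
    intervalIntegral.integral_of_le (by positivity), NNReal.smul_def, smul_eq_mul]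
  simp

lemma abs_integral_timeAverage_sub_le (x : T2) (n : ℕ) (t : ℝ) {f : T2 → ℝ} (hf : Continuous f)
    {C : ℝ} (hC : ∀ y, |f y| ≤ C) :
    |∫ y, f (h.flow t y) ∂h.timeAverage x n - ∫ y, f y ∂h.timeAverage x n| ≤
      (n + 1 : ℝ)⁻¹ * (2 * (C * |t|)) := by
  have hfx : Continuous fun s => f (h.flow s x) := hf.comp (h.continuous_orbit x)
  have hi : ∀ a b, IntervalIntegrable (fun s => f (h.flow s x)) volume a b := fun a b =>
    hfx.intervalIntegrable a b
  have hbound : ∀ a b, |∫ s in a..b, f (h.flow s x)| ≤ C * |b - a| := fun a b => by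
    rw [← Real.norm_eq_abs]
    exact intervalIntegral.norm_integral_le_of_norm_le_const fun s _ => hC _
  rw [h.integral_timeAverage x n (f := fun y => f (h.flow t y)) (hf.comp (h.continuous_flow t)),
    h.integral_timeAverage x n hf,
    ← mul_sub, abs_mul, abs_of_pos (by positivity : (0 : ℝ) < (n + 1 : ℝ)⁻¹)]
  gcongr
  simp only [← h.flow_add]
  rw [intervalIntegral.integral_comp_add_left (fun s => f (h.flow s x)) t,
    intervalIntegral.integral_interval_sub_interval_comm (hi _ _) (hi _ _) (hi _ _)]
  refine (abs_sub _ _).trans ?_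
  have h1 := hbound (t + 0) 0
  have h2 := hbound (t + (n + 1)) (n + 1)
  rw [add_zero, zero_sub, abs_neg] at h1
  rw [sub_add_cancel_right, abs_neg] at h2
  rw [add_zero]
  linarith

/-- The Krylov–Bogoliubov theorem for flows of the torus. -/
lemma exists_invariant : ∃ μ : Measure T2, IsProbabilityMeasure μ ∧
    ∀ t, MeasurePreserving (h.flow t) μ μ := by
  let m : ℕ → ProbabilityMeasure T2 := fun n => ⟨h.timeAverage 0 n, inferInstance⟩
  let u : Ultrafilter ℕ := Ultrafilter.of atTop
  have hu : (u : Filter ℕ) ≤ atTop := Ultrafilter.of_le atTop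
  obtain ⟨μ, -, hμ⟩ := isCompact_univ.ultrafilter_le_nhds (u.map m) (by simp)
  have hlim : Tendsto m u (𝓝 μ) := hμ
  rw [ProbabilityMeasure.tendsto_iff_forall_integral_tendsto] at hlim
  refine ⟨μ, inferInstance, fun t => ⟨(h.continuous_flow t).measurable, ?_⟩⟩
  have := Measure.isProbabilityMeasure_map (μ := (μ : Measure T2))
    (h.continuous_flow t).measurable.aemeasurable
  refine ext_of_forall_integral_eq_of_IsFiniteMeasure fun f => ?_
  rw [integral_map (h.continuous_flow t).measurable.aemeasurable
    f.continuous.aestronglyMeasurable]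
  have h1 := hlim (f.compContinuous ⟨h.flow t, h.continuous_flow t⟩)
  have h2 := hlim f
  have h3 : Tendsto (fun n : ℕ => ((n : ℝ) + 1)⁻¹ * (2 * (‖f‖ * |t|))) u (𝓝 0) := by
    have := (tendsto_one_div_add_atTop_nhds_zero_nat (𝕜 := ℝ)).mul_const (2 * (‖f‖ * |t|))
    simp only [one_div, zero_mul] at this
    exact this.mono_left hu
  refine sub_eq_zero.1 (tendsto_nhds_unique (h1.sub h2) (squeeze_zero_norm (fun n => ?_) h3))
  rw [Real.norm_eq_abs]
  exact h.abs_integral_timeAverage_sub_le 0 n t f.continuous f.norm_coe_le_norm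

end C1FlowT2

end

/-- Every `C¹` flow on `𝕋²` without critical points and without periodic orbits is
uniquely ergodic: there is exactly one invariant Borel probability measure. -/
theorem unique_ergodicity (h : C1FlowT2)
    (hcrit : h.NoCriticalPoints) (hper : h.NoPeriodicOrbits) :
    ∃! μ : Measure T2, IsProbabilityMeasure μ ∧ ∀ t, MeasurePreserving (h.flow t) μ μ := by
  obtain ⟨μ, hμ, hinv⟩ := h.exists_invariant
  refine ⟨μ, ⟨hμ, hinv⟩, fun ν hν => ?_⟩
  have := hν.1
  exact eq_of_invariant hcrit hper hν.2 hinv
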